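/- arXiv:2406.13582 — 9 statements merged into one kernel-verified Lean document; each statement's English description precedes it below -/
import Mathlib

section
/- Let R be a semilocal ring and let S and T be simple right R-modules that are not isomorphic, such that Ext^1_R(S, T) ≠ 0 (equivalently, there exists a non-split short exact sequence 0 → T → K → S → 0 of right R-modules). Let I be the annihilator of S and J the annihilator of T (both two-sided ideals of R). Then the product ideal I·J is strictly contained in the intersection I ∩ J. -/
universe u

/-- `Ext¹_A(S, T) ≠ 0`: there exists a short exact sequence `0 → T → K → S → 0`
of `A`-modules that does not split. -/
def ExtOne (A : Type u) [Ring A] (S T : Type u) [AddCommGroup S] [Module A S]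
    [AddCommGroup T] [Module A T] : Prop :=
  ∃ (K : Type u) (_ : AddCommGroup K) (_ : Module A K)
    (i : T →ₗ[A] K) (p : K →ₗ[A] S),
      Function.Injective i ∧ Function.Surjective p ∧
      LinearMap.range i = LinearMap.ker p ∧
      ∀ s : S →ₗ[A] K, p ∘ₗ s ≠ LinearMap.id

theorem isSemisimpleModule_of_surjective_of_ker_smul {A B M : Type*} [Ring A] [Ring B]
    [AddCommGroup M] [Module A M] [IsSemisimpleRing B] (f : A →+* B)
    (hf : Function.Surjective f) (hM : ∀ a, f a = 0 → ∀ m : M, a • m = 0) :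
    IsSemisimpleModule A M := by
  have : IsSemisimpleRing (A ⧸ RingHom.ker f) :=
    (RingHom.quotientKerEquivOfSurjective hf).symm.isSemisimpleRing
  have htors : Module.IsTorsionBySet A M (RingHom.ker f) := fun m a ↦
    hM a (RingHom.mem_ker.mp a.2) m
  let _ := htors.module
  exact htors.isSemisimpleModule_iff.mp inferInstance

namespace TwoSidedIdeal

variable {R : Type*} [Ring R]

theorem exists_mul_one_sub_eq_one_of_mem_jacobson_bot {x : R}
    (hx : x ∈ (⊥ : TwoSidedIdeal R).jacobson) : ∃ z, z * (1 - x) = 1 := by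
  obtain ⟨z, hz⟩ := mem_jacobson_iff.mp hx (-1)
  refine ⟨z, ?_⟩
  rw [mem_bot] at hz
  rw [← sub_eq_zero, ← hz]
  noncomm_ring

theorem isUnit_one_sub_of_mem_jacobson_bot {x : R}
    (hx : x ∈ (⊥ : TwoSidedIdeal R).jacobson) : IsUnit (1 - x) := by
  obtain ⟨z, hz⟩ := exists_mul_one_sub_eq_one_of_mem_jacobson_bot hx
  have hzx : 1 - -(z * x) = z := by
    rw [← hz]
    noncomm_ring
  obtain ⟨w, hw⟩ := exists_mul_one_sub_eq_one_of_mem_jacobson_bot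
    (neg_mem _ (mul_mem_left _ z x hx))
  rw [hzx] at hw
  obtain rfl : w = 1 - x := left_inv_eq_right_inv hw hz
  exact ⟨⟨_, z, hw, hz⟩, rfl⟩

/-- The Jacobson radical, defined through left ideals, annihilates every simple right module. -/
theorem op_smul_eq_zero_of_mem_jacobson_bot {M : Type*} [AddCommGroup M] [Module Rᵐᵒᵖ M]
    [IsSimpleModule Rᵐᵒᵖ M] {r : R} (hr : r ∈ (⊥ : TwoSidedIdeal R).jacobson) (m : M) :
    MulOpposite.op r • m = 0 := by
  by_contra hne
  obtain ⟨y, hy⟩ := IsSimpleModule.toSpanSingleton_surjective Rᵐᵒᵖ hne m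
  have hfix : MulOpposite.op (1 - r * y.unop) • m = 0 := by
    simpa [sub_smul, mul_smul, sub_eq_zero] using hy.symm
  have hunit := (isUnit_one_sub_of_mem_jacobson_bot (mul_mem_right _ r y.unop hr)).op
  rw [hunit.smul_eq_zero] at hfix
  exact hne (by rw [hfix, smul_zero])

/-- A right module annihilated by the Jacobson radical of a semilocal ring is semisimple. -/
theorem isSemisimpleModule_op_of_jacobson_bot
    [IsSemisimpleRing ((⊥ : TwoSidedIdeal R).jacobson.ringCon.Quotient)]
    {M : Type*} [AddCommGroup M] [Module Rᵐᵒᵖ M]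
    (hM : ∀ r ∈ (⊥ : TwoSidedIdeal R).jacobson, ∀ m : M, MulOpposite.op r • m = 0) :
    IsSemisimpleModule Rᵐᵒᵖ M := by
  refine isSemisimpleModule_of_surjective_of_ker_smul
    (RingHom.op (⊥ : TwoSidedIdeal R).jacobson.ringCon.mk')
    (fun b ↦ ?_) fun a ha ↦ hM a.unop ?_
  · obtain ⟨r, hr⟩ := RingCon.mk'_surjective _ b.unop
    exact ⟨MulOpposite.op r, MulOpposite.unop_injective hr⟩
  · rw [← ker_ringCon_mk' (⊥ : TwoSidedIdeal R).jacobson, mem_ker]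
    exact MulOpposite.op_injective ha

end TwoSidedIdeal

/-- Let `R` be a semilocal ring (`R/J(R)` is a semisimple ring) and `S`, `T` be
simple non-isomorphic right `R`-modules with `Ext¹_R(S, T) ≠ 0`.  If `I` and `J`
are their respective annihilators, then the product ideal `I·J` (the additive
closure of the set of products) is strictly contained in `I ∩ J`. -/
theorem annihilator_product_lt_inter (R : Type u) [Ring R]
    (hsemilocal : IsSemisimpleRing ((⊥ : TwoSidedIdeal R).jacobson.ringCon.Quotient))
    (S T : Type u) [AddCommGroup S] [Module Rᵐᵒᵖ S] [AddCommGroup T] [Module Rᵐᵒᵖ T]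
    (hS : IsSimpleModule Rᵐᵒᵖ S) (hT : IsSimpleModule Rᵐᵒᵖ T)
    (hniso : IsEmpty (S ≃ₗ[Rᵐᵒᵖ] T))
    (hext : ExtOne Rᵐᵒᵖ S T)
    (I : Set R) (hI : I = {r : R | ∀ m : S, (MulOpposite.op r) • m = 0})
    (J : Set R) (hJ : J = {r : R | ∀ m : T, (MulOpposite.op r) • m = 0}) :
    ((AddSubgroup.closure {x : R | ∃ a ∈ I, ∃ b ∈ J, x = a * b} : AddSubgroup R) : Set R)
      ⊂ I ∩ J := by
  subst hI hJ
  obtain ⟨K, _, _, i, p, -, hp, hip, hsplit⟩ := hext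
  refine ⟨?_, fun hle ↦ ?_⟩
  · intro x hx
    induction hx using AddSubgroup.closure_induction with
    | mem x hx =>
      obtain ⟨a, ha, b, hb, rfl⟩ := hx
      exact ⟨fun m ↦ by rw [MulOpposite.op_mul, mul_smul, ha, smul_zero],
        fun m ↦ by rw [MulOpposite.op_mul, mul_smul, hb]⟩
    | zero => exact ⟨fun m ↦ by simp, fun m ↦ by simp⟩
    | add x y _ _ hx hy =>
      exact ⟨fun m ↦ by rw [MulOpposite.op_add, add_smul, hx.1, hy.1, add_zero],
        fun m ↦ by rw [MulOpposite.op_add, add_smul, hx.2, hy.2, add_zero]⟩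
    | neg x _ hx =>
      exact ⟨fun m ↦ by rw [MulOpposite.op_neg, neg_smul, hx.1, neg_zero],
        fun m ↦ by rw [MulOpposite.op_neg, neg_smul, hx.2, neg_zero]⟩
  · have hK : IsSemisimpleModule Rᵐᵒᵖ K := by
      refine TwoSidedIdeal.isSemisimpleModule_op_of_jacobson_bot fun r hr k ↦ ?_
      have hmem := hle ⟨fun m ↦ TwoSidedIdeal.op_smul_eq_zero_of_mem_jacobson_bot hr m,
        fun m ↦ TwoSidedIdeal.op_smul_eq_zero_of_mem_jacobson_bot hr m⟩
      clear hr
      induction hmem using AddSubgroup.closure_induction with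
      | mem x hx =>
        obtain ⟨a, ha, b, hb, rfl⟩ := hx
        have hker : MulOpposite.op a • k ∈ LinearMap.ker p := by
          rw [LinearMap.mem_ker, map_smul, ha]
        obtain ⟨t, ht⟩ := hip.ge hker
        rw [MulOpposite.op_mul, mul_smul, ← ht, ← map_smul, hb, map_zero]
      | zero => simp
      | add x y _ _ hx hy => rw [MulOpposite.op_add, add_smul, hx, hy, add_zero]
      | neg x _ hx => rw [MulOpposite.op_neg, neg_smul, hx, neg_zero]
    obtain ⟨s, hs⟩ := IsSemisimpleModule.lifting_property p hp LinearMap.id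
    exact hsplit s hs
end

section
/- Let R be a right artinian ring with J(R)² = 0 and let S and T be simple right R-modules. Then the following are equivalent: (i) there is a finite sequence of finitely generated indecomposable projective right R-modules P(S) = P₁, P₂, …, P_k = P(T), starting at the projective cover of S and ending at the projective cover of T, such that any two consecutive members have a common composition factor; (ii) there is an Ext-path from S to T. -/
universe u

/-- An Ext-path from `S` to `T`: a finite sequence of simple `A`-modules starting
at (a copy of) `S` and ending at (a copy of) `T` such that consecutive members have a
nontrivial extension in one direction or the other. -/
def ExtPath (A : Type u) [Ring A] (S T : Type u) [AddCommGroup S] [Module A S]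
    [AddCommGroup T] [Module A T] : Prop :=
  ∃ (n : ℕ) (M : Fin (n + 1) → Type u)
    (_ : ∀ i, AddCommGroup (M i)) (_ : ∀ i, Module A (M i)),
      (∀ i, IsSimpleModule A (M i)) ∧
      Nonempty (M 0 ≃ₗ[A] S) ∧
      Nonempty (M (Fin.last n) ≃ₗ[A] T) ∧
      ∀ i : Fin n,
        ExtOne A (M i.castSucc) (M i.succ) ∨ ExtOne A (M i.succ) (M i.castSucc)

/-- The radical `J(P) = P·J(R)` of a right `R`-module `P`. -/
def radSubmodule (R : Type u) [Ring R] (P : Type u) [AddCommGroup P]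
    [Module Rᵐᵒᵖ P] : Submodule Rᵐᵒᵖ P :=
  Submodule.span Rᵐᵒᵖ
    {x : P | ∃ r ∈ (⊥ : TwoSidedIdeal R).jacobson, ∃ m : P, x = (MulOpposite.op r) • m}

/-- A module is indecomposable if it is nonzero and admits no nontrivial
direct sum decomposition. -/
def IsIndecomposableModule (A : Type u) [Ring A] (P : Type u) [AddCommGroup P]
    [Module A P] : Prop :=
  Nontrivial P ∧ ∀ N N' : Submodule A P, IsCompl N N' → N = ⊥ ∨ N = ⊤

/-- `V` is (isomorphic to) a subquotient of `P` arising from a pair of submodules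
`N₁ < N₂`; for simple `V` and finite length `P` this says exactly that `V` is a
composition factor of `P`. -/
def IsCompositionFactorOf (A : Type u) [Ring A] (V P : Type u) [AddCommGroup V]
    [Module A V] [AddCommGroup P] [Module A P] : Prop :=
  ∃ N₁ N₂ : Submodule A P, N₁ < N₂ ∧
    Nonempty ((↥N₂ ⧸ Submodule.comap N₂.subtype N₁) ≃ₗ[A] V)

/-- `P` is a projective cover of `M`: `P` is projective and there is a surjection
`P → M` whose kernel is superfluous (small) in `P`. -/
def IsProjectiveCover (A : Type u) [Ring A] (P M : Type u) [AddCommGroup P]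
    [Module A P] [AddCommGroup M] [Module A M] : Prop :=
  Module.Projective A P ∧ ∃ f : P →ₗ[A] M, Function.Surjective f ∧
    ∀ N : Submodule A P, N ⊔ LinearMap.ker f = ⊤ → N = ⊤

/-- The socle of a module: the sum of all of its simple submodules. -/
def Socle (A : Type u) [Ring A] (M : Type u) [AddCommGroup M] [Module A M] :
    Submodule A M :=
  sSup {N : Submodule A M | IsSimpleModule A ↥N}

section

variable {A : Type u} [Ring A]

theorem sup_ker_eq_top_iff {P M : Type*} [AddCommGroup P] [Module A P] [AddCommGroup M]
    [Module A M] {f : P →ₗ[A] M} (hf : Function.Surjective f) (N : Submodule A P) :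
    N ⊔ LinearMap.ker f = ⊤ ↔ N.map f = ⊤ :=
  (LinearMap.map_eq_top_iff (LinearMap.range_eq_top.2 hf)).symm

/-- A finite length projective module surjecting onto `M` has a direct summand which is minimal
among the submodules surjecting onto `M`. -/
theorem exists_minimal_retract_sup_ker_eq_top {P M : Type*} [AddCommGroup P] [Module A P]
    [AddCommGroup M] [Module A M] [Module.Projective A P] [IsArtinian A P] [IsNoetherian A P]
    {f : P →ₗ[A] M} (hf : Function.Surjective f) :
    ∃ (N : Submodule A P) (r : P →ₗ[A] N), (∀ x : N, r x = x) ∧ N ⊔ LinearMap.ker f = ⊤ ∧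
      ∀ N' ≤ N, N' ⊔ LinearMap.ker f = ⊤ → N' = N := by
  obtain ⟨N, hN, hmin⟩ := WellFounded.has_min (wellFounded_lt (α := Submodule A P))
    {N | N ⊔ LinearMap.ker f = ⊤} ⟨⊤, by simp⟩
  replace hmin : ∀ N' ≤ N, N' ⊔ LinearMap.ker f = ⊤ → N' = N := fun N' hle h ↦
    hle.eq_of_not_lt (hmin N' h)
  replace hN : N ⊔ LinearMap.ker f = ⊤ := hN
  have hfN : Function.Surjective (f ∘ₗ N.subtype) := by
    rw [sup_ker_eq_top_iff hf] at hN
    rw [← LinearMap.range_eq_top, LinearMap.range_comp, Submodule.range_subtype, hN]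
  obtain ⟨g, hg⟩ := Module.projective_lifting_property (f ∘ₗ N.subtype) f hfN
  have hgf : ∀ x, f (g x) = f x := fun x ↦ LinearMap.congr_fun hg x
  have hgN : Function.Surjective (g ∘ₗ N.subtype) := by
    rw [← LinearMap.range_eq_top]
    apply Submodule.map_injective_of_injective N.injective_subtype
    rw [Submodule.map_top, Submodule.range_subtype]
    refine hmin _ (Submodule.map_subtype_le _ _) ?_
    rw [sup_ker_eq_top_iff hf, eq_top_iff]
    intro m _
    obtain ⟨x, rfl⟩ := hfN m
    exact ⟨g x, ⟨g x, ⟨x, rfl⟩, rfl⟩, hgf x⟩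
  have hbij : Function.Bijective (g ∘ₗ N.subtype) :=
    ⟨IsNoetherian.injective_of_surjective_endomorphism _ hgN, hgN⟩
  refine ⟨N, (LinearEquiv.ofBijective _ hbij).symm.toLinearMap ∘ₗ g, fun x ↦ ?_, hN, hmin⟩
  exact (LinearEquiv.ofBijective _ hbij).symm_apply_apply x

theorem IsProjectiveCover.isIndecomposableModule {P S : Type u} [AddCommGroup P] [Module A P]
    [AddCommGroup S] [Module A S] [IsSimpleModule A S] (h : IsProjectiveCover A P S) :
    IsIndecomposableModule A P := by
  obtain ⟨-, f, hf, hsup⟩ := h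
  have := IsSimpleModule.nontrivial A S
  refine ⟨hf.nontrivial, fun N N' hc ↦ ?_⟩
  by_cases hN : N ⊔ LinearMap.ker f = ⊤
  · exact .inr (hsup N hN)
  have hle : N ≤ LinearMap.ker f := sup_eq_right.1 <|
    ((LinearMap.isCoatom_ker_of_surjective hf).le_iff.1 le_sup_right).resolve_left hN
  have : N' = ⊤ := hsup N' (top_unique (by
    rw [← hc.sup_eq_top, sup_comm]; exact sup_le_sup_left hle _))
  exact .inl (by simpa [this] using hc.disjoint.eq_bot)

theorem exists_isProjectiveCover_of_isSimpleModule [IsArtinianRing A] (S : Type u)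
    [AddCommGroup S] [Module A S] [IsSimpleModule A S] :
    ∃ (P : Type u) (_ : AddCommGroup P) (_ : Module A P),
      Module.Finite A P ∧ IsProjectiveCover A P S := by
  have := IsSimpleModule.nontrivial A S
  obtain ⟨s, hs⟩ := exists_ne (0 : S)
  have hf := IsSimpleModule.toSpanSingleton_surjective A hs
  obtain ⟨N, r, hr, hN, hmin⟩ := exists_minimal_retract_sup_ker_eq_top hf
  refine ⟨N, inferInstance, inferInstance, inferInstance,
    .of_split N.subtype r (LinearMap.ext hr), LinearMap.toSpanSingleton A S s ∘ₗ N.subtype,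
    ?_, fun N' hN' ↦ ?_⟩
  · rw [sup_ker_eq_top_iff hf] at hN
    rw [← LinearMap.range_eq_top, LinearMap.range_comp, Submodule.range_subtype, hN]
  · set f := LinearMap.toSpanSingleton A S s
    apply Submodule.map_injective_of_injective N.injective_subtype
    rw [Submodule.map_top, Submodule.range_subtype]
    refine hmin _ (Submodule.map_subtype_le _ _) ?_
    rw [sup_ker_eq_top_iff hf] at hN ⊢
    rw [← hN, ← Submodule.map_comp]
    have hmap := congrArg (Submodule.map (f ∘ₗ N.subtype)) hN'
    rw [Submodule.map_sup, (LinearMap.le_ker_iff_map (f := f ∘ₗ N.subtype)).1 le_rfl,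
      sup_bot_eq] at hmap
    rw [hmap, Submodule.map_comp, Submodule.map_top, Submodule.range_subtype]

theorem IsIndecomposableModule.exists_isProjectiveCover [IsArtinianRing A] {P : Type u}
    [AddCommGroup P] [Module A P] [Module.Finite A P] [Module.Projective A P]
    (h : IsIndecomposableModule A P) :
    ∃ (S : Type u) (_ : AddCommGroup S) (_ : Module A S),
      IsSimpleModule A S ∧ IsProjectiveCover A P S := by
  have := h.1
  obtain ⟨m, hm, -⟩ := (eq_top_or_exists_le_coatom (⊥ : Submodule A P)).resolve_left bot_ne_top
  have hS : IsSimpleModule A (P ⧸ m) := isSimpleModule_iff_isCoatom.2 hm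
  obtain ⟨N, r, hr, hN, hmin⟩ := exists_minimal_retract_sup_ker_eq_top m.mkQ_surjective
  refine ⟨P ⧸ m, inferInstance, inferInstance, hS, inferInstance, m.mkQ, m.mkQ_surjective, ?_⟩
  obtain rfl | rfl := h.2 N _ (LinearMap.isCompl_of_proj hr)
  · rw [bot_sup_eq, Submodule.ker_mkQ] at hN
    exact absurd hN hm.1
  · exact fun N' ↦ hmin N' le_top

theorem IsProjectiveCover.nonempty_linearEquiv {P S T : Type u} [AddCommGroup P] [Module A P]
    [AddCommGroup S] [Module A S] [AddCommGroup T] [Module A T] [IsSimpleModule A S]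
    [IsSimpleModule A T] (hS : IsProjectiveCover A P S) (hT : IsProjectiveCover A P T) :
    Nonempty (S ≃ₗ[A] T) := by
  obtain ⟨-, f, hf, hsup⟩ := hS
  obtain ⟨-, g, hg, -⟩ := hT
  have hfc := LinearMap.isCoatom_ker_of_surjective hf
  have hgc := LinearMap.isCoatom_ker_of_surjective hg
  have heq : LinearMap.ker f = LinearMap.ker g := by
    by_contra hne
    exact hgc.1 (hsup _ (hgc.sup_eq_top_of_ne hfc (Ne.symm hne)))
  exact ⟨(f.quotKerEquivOfSurjective hf).symm ≪≫ₗ Submodule.quotEquivOfEq _ _ heq ≪≫ₗ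
    g.quotKerEquivOfSurjective hg⟩

theorem IsProjectiveCover.congr {P S T : Type u} [AddCommGroup P] [Module A P]
    [AddCommGroup S] [Module A S] [AddCommGroup T] [Module A T]
    (h : IsProjectiveCover A P S) (e : S ≃ₗ[A] T) : IsProjectiveCover A P T := by
  obtain ⟨hP, f, hf, hsup⟩ := h
  exact ⟨hP, e.toLinearMap ∘ₗ f, e.surjective.comp hf, by rwa [LinearEquiv.ker_comp]⟩

theorem isCompositionFactorOf_iff {V P : Type u} [AddCommGroup V] [Module A V] [Nontrivial V]
    [AddCommGroup P] [Module A P] :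
    IsCompositionFactorOf A V P ↔
      ∃ (N : Submodule A P) (g : N →ₗ[A] V), Function.Surjective g := by
  constructor
  · rintro ⟨N₁, N₂, -, ⟨e⟩⟩
    exact ⟨N₂, e.toLinearMap ∘ₗ Submodule.mkQ _, e.surjective.comp (Submodule.mkQ_surjective _)⟩
  · rintro ⟨N, g, hg⟩
    have hc : Submodule.comap N.subtype ((LinearMap.ker g).map N.subtype) = LinearMap.ker g :=
      Submodule.comap_map_eq_of_injective N.injective_subtype _
    refine ⟨(LinearMap.ker g).map N.subtype, N,
      (Submodule.map_subtype_le _ _).lt_of_ne fun heq ↦ ?_,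
      ⟨Submodule.quotEquivOfEq _ _ hc ≪≫ₗ g.quotKerEquivOfSurjective hg⟩⟩
    obtain ⟨v, hv⟩ := exists_ne (0 : V)
    obtain ⟨x, rfl⟩ := hg v
    rw [heq, Submodule.comap_subtype_self] at hc
    exact hv (hc ▸ Submodule.mem_top : x ∈ LinearMap.ker g)

theorem ExtOne.congr {S S' T T' : Type u} [AddCommGroup S] [Module A S] [AddCommGroup S']
    [Module A S'] [AddCommGroup T] [Module A T] [AddCommGroup T'] [Module A T']
    (h : ExtOne A S T) (e : S ≃ₗ[A] S') (e' : T ≃ₗ[A] T') : ExtOne A S' T' := by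
  obtain ⟨K, _, _, i, p, hi, hp, hip, hs⟩ := h
  refine ⟨K, inferInstance, inferInstance, i ∘ₗ e'.symm.toLinearMap, e.toLinearMap ∘ₗ p,
    hi.comp e'.symm.injective, e.surjective.comp hp, ?_, fun s hps ↦ ?_⟩
  · rw [LinearEquiv.ker_comp, ← hip, LinearMap.range_comp, LinearEquiv.range, Submodule.map_top]
  · refine hs (s ∘ₗ e.toLinearMap) (LinearMap.ext fun x ↦ e.injective ?_)
    exact LinearMap.congr_fun hps (e x)

theorem ExtOne.isCompositionFactorOf {P S V : Type u} [AddCommGroup P] [Module A P]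
    [AddCommGroup S] [Module A S] [AddCommGroup V] [Module A V] [IsSimpleModule A V]
    (h : ExtOne A S V) (hP : IsProjectiveCover A P S) :
    IsCompositionFactorOf A V P := by
  have := IsSimpleModule.nontrivial A V
  obtain ⟨K, _, _, i, p, hi, hp, hip, hs⟩ := h
  obtain ⟨_, f, hf, -⟩ := hP
  obtain ⟨φ, hφ⟩ := Module.projective_lifting_property p f hp
  have hpφ : ∀ x, p (φ x) = f x := LinearMap.congr_fun hφ
  have hle : LinearMap.range i ≤ LinearMap.range φ := by
    by_contra hle
    have hdisj : ∀ x ∈ LinearMap.range φ, p x = 0 → x = 0 := by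
      intro x hx hpx
      have hbot : (LinearMap.range φ).comap i = ⊥ :=
        (eq_bot_or_eq_top _).resolve_right fun h ↦ hle (by
          rintro _ ⟨v, rfl⟩
          exact (h ▸ Submodule.mem_top : v ∈ (LinearMap.range φ).comap i))
      obtain ⟨v, rfl⟩ : x ∈ LinearMap.range i := hip ▸ hpx
      rw [(Submodule.mem_bot A).1 (hbot ▸ hx : v ∈ (⊥ : Submodule A V)), map_zero]
    have hker : LinearMap.ker f ≤ LinearMap.ker φ := fun x hx ↦
      hdisj _ ⟨x, rfl⟩ ((hpφ x).trans hx)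
    refine hs ((LinearMap.ker f).liftQ φ hker ∘ₗ
      (f.quotKerEquivOfSurjective hf).symm.toLinearMap) (LinearMap.ext fun y ↦ ?_)
    obtain ⟨x, rfl⟩ := hf y
    have : (f.quotKerEquivOfSurjective hf).symm (f x) = Submodule.Quotient.mk x := by
      rw [LinearEquiv.symm_apply_eq]; rfl
    simp [this, hpφ]
  rw [isCompositionFactorOf_iff]
  refine ⟨(LinearMap.range i).comap φ, (LinearEquiv.ofInjective i hi).symm.toLinearMap ∘ₗ
    φ.restrict fun x hx ↦ hx, (LinearEquiv.ofInjective i hi).symm.surjective.comp ?_⟩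
  rintro ⟨y, hy⟩
  obtain ⟨x, rfl⟩ := hle hy
  exact ⟨⟨x, hy⟩, rfl⟩

theorem IsProjectiveCover.isCompositionFactorOf {P S : Type u} [AddCommGroup P] [Module A P]
    [AddCommGroup S] [Module A S] [IsSimpleModule A S] (hP : IsProjectiveCover A P S) :
    IsCompositionFactorOf A S P := by
  have := IsSimpleModule.nontrivial A S
  obtain ⟨-, f, hf, -⟩ := hP
  exact isCompositionFactorOf_iff.2 ⟨⊤, f ∘ₗ Submodule.subtype ⊤,
    hf.comp fun x ↦ ⟨⟨x, Submodule.mem_top⟩, rfl⟩⟩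

/-- A module over an artinian ring is semisimple if the Jacobson radical annihilates it. -/
theorem isSemisimpleModule_of_jacobson_smul_eq_zero [IsArtinianRing A] {M : Type*}
    [AddCommGroup M] [Module A M] (h : ∀ a ∈ Ring.jacobson A, ∀ m : M, a • m = 0) :
    IsSemisimpleModule A M := by
  have htor : Module.IsTorsionBySet A M (Ring.jacobson A) := fun {m} a ↦ h a a.2 m
  let _ := htor.module
  exact (htor.semilinearMap.isSemisimpleModule_iff_of_bijective Function.bijective_id).2
    inferInstance

theorem isSemisimpleModule_ker_of_superfluous [IsArtinianRing A]
    (hJ : ∀ a ∈ Ring.jacobson A, ∀ b ∈ Ring.jacobson A, a * b = 0)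
    {P S : Type*} [AddCommGroup P] [Module A P] [AddCommGroup S] [Module A S]
    {f : P →ₗ[A] S} (hsup : ∀ N : Submodule A P, N ⊔ LinearMap.ker f = ⊤ → N = ⊤) :
    IsSemisimpleModule A (LinearMap.ker f) := by
  set J : Submodule A P := Ring.jacobson A • ⊤
  have hss : IsSemisimpleModule A (P ⧸ J) := by
    refine isSemisimpleModule_of_jacobson_smul_eq_zero fun a ha m ↦ ?_
    obtain ⟨x, rfl⟩ := J.mkQ_surjective m
    rw [← map_smul, Submodule.mkQ_apply, Submodule.Quotient.mk_eq_zero]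
    exact Submodule.smul_mem_smul ha Submodule.mem_top
  have hle : LinearMap.ker f ≤ J := by
    obtain ⟨C, hC⟩ := exists_isCompl ((LinearMap.ker f).map J.mkQ)
    have hCtop : C.comap J.mkQ = ⊤ := by
      refine hsup _ (eq_top_iff.2 fun x _ ↦ ?_)
      obtain ⟨_, ⟨y, hy, rfl⟩, c, hc, hx⟩ :=
        Submodule.mem_sup.1 (hC.sup_eq_top ▸ Submodule.mem_top : J.mkQ x ∈ _)
      refine Submodule.mem_sup.2 ⟨x - y, ?_, y, hy, sub_add_cancel x y⟩
      rw [Submodule.mem_comap, map_sub, ← hx, add_sub_cancel_left]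
      exact hc
    rw [← J.ker_mkQ, LinearMap.le_ker_iff_map, eq_bot_iff, ← hC.disjoint.eq_bot]
    refine le_inf le_rfl (Submodule.map_le_iff_le_comap.2 (hCtop ▸ le_top))
  refine isSemisimpleModule_of_jacobson_smul_eq_zero fun a ha ⟨m, hmf⟩ ↦ Subtype.ext ?_
  have hm := hle hmf
  change a • m = 0
  clear hmf
  induction hm using Submodule.smul_induction_on' with
  | smul b hb x _ => rw [← mul_smul, hJ a ha b hb, zero_smul]
  | add x _ y _ hx hy => rw [smul_add, hx, hy, add_zero]

theorem IsProjectiveCover.nonempty_linearEquiv_or_extOne [IsArtinianRing A]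
    (hJ : ∀ a ∈ Ring.jacobson A, ∀ b ∈ Ring.jacobson A, a * b = 0)
    {P S V : Type u} [AddCommGroup P] [Module A P] [AddCommGroup S] [Module A S]
    [AddCommGroup V] [Module A V] [IsSimpleModule A S] [IsSimpleModule A V]
    (hP : IsProjectiveCover A P S) (hV : IsCompositionFactorOf A V P) :
    Nonempty (S ≃ₗ[A] V) ∨ ExtOne A S V := by
  have := IsSimpleModule.nontrivial A V
  obtain ⟨-, f, hf, hsup⟩ := hP
  obtain ⟨N, g, hg⟩ := isCompositionFactorOf_iff.1 hV
  have hss := isSemisimpleModule_ker_of_superfluous hJ hsup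
  have hgne : g ≠ 0 := by
    rintro rfl
    obtain ⟨v, hv⟩ := exists_ne (0 : V)
    obtain ⟨x, hx⟩ := hg v
    exact hv hx.symm
  by_cases hker : LinearMap.ker (f ∘ₗ N.subtype) ≤ LinearMap.ker g
  · left
    have hfN : Function.Surjective (f ∘ₗ N.subtype) := by
      refine LinearMap.surjective_of_ne_zero fun h0 ↦ hgne ?_
      rwa [h0, LinearMap.ker_zero, top_le_iff, LinearMap.ker_eq_top] at hker
    have heq : LinearMap.ker (f ∘ₗ N.subtype) = LinearMap.ker g :=
      ((LinearMap.isCoatom_ker_of_surjective hfN).le_iff_eq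
        (LinearMap.isCoatom_ker_of_surjective hg).1).1 hker |>.symm
    exact ⟨(LinearMap.quotKerEquivOfSurjective _ hfN).symm ≪≫ₗ
      Submodule.quotEquivOfEq _ _ heq ≪≫ₗ g.quotKerEquivOfSurjective hg⟩
  right
  obtain ⟨x, hxf, hxg⟩ := SetLike.not_le_iff_exists.1 hker
  let ι : LinearMap.ker (f ∘ₗ N.subtype) →ₗ[A] LinearMap.ker f :=
    (N.subtype ∘ₗ Submodule.subtype _).codRestrict _ fun y ↦ y.2
  have hι : Function.Injective ι := fun y z h ↦
    Subtype.ext (Subtype.ext (congrArg Subtype.val h :))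
  obtain ⟨k, hk⟩ := IsSemisimpleModule.extension_property ι hι (g ∘ₗ Submodule.subtype _)
  have hksurj : Function.Surjective k := by
    refine LinearMap.surjective_of_ne_zero ?_
    rintro rfl
    exact hxg (LinearMap.congr_fun hk ⟨x, hxf⟩).symm
  let L : Submodule A P := (LinearMap.ker k).map (Submodule.subtype _)
  have hmemL : ∀ y : LinearMap.ker f, (y : P) ∈ L ↔ k y = 0 := fun y ↦ by
    simp [L]
  have hLle : L ≤ LinearMap.ker f := Submodule.map_subtype_le _ _
  let j : LinearMap.ker f →ₗ[A] P ⧸ L := L.mkQ ∘ₗ Submodule.subtype _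
  have hkj : LinearMap.ker k = LinearMap.ker j := by
    ext y
    simp only [LinearMap.mem_ker, ← hmemL, j, LinearMap.comp_apply, Submodule.mkQ_apply,
      Submodule.Quotient.mk_eq_zero, Submodule.subtype_apply]
  let i : V →ₗ[A] P ⧸ L := (LinearMap.ker k).liftQ j hkj.le ∘ₗ
    (k.quotKerEquivOfSurjective hksurj).symm.toLinearMap
  have hik : ∀ y, i (k y) = L.mkQ y := fun y ↦ by
    have : (k.quotKerEquivOfSurjective hksurj).symm (k y) = Submodule.Quotient.mk y := by
      rw [LinearEquiv.symm_apply_eq]; rfl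
    simp [i, j, this]
  refine ⟨P ⧸ L, inferInstance, inferInstance, i, L.liftQ f hLle, ?_, ?_, ?_, fun s hs ↦ ?_⟩
  · rw [injective_iff_map_eq_zero]
    intro v hv
    obtain ⟨y, rfl⟩ := hksurj v
    rwa [hik, Submodule.mkQ_apply, Submodule.Quotient.mk_eq_zero, hmemL] at hv
  · intro y
    obtain ⟨z, rfl⟩ := hf y
    exact ⟨L.mkQ z, rfl⟩
  · ext z
    obtain ⟨z, rfl⟩ := L.mkQ_surjective z
    constructor
    · rintro ⟨v, hv⟩
      obtain ⟨y, rfl⟩ := hksurj v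
      rw [← hv, hik]
      exact y.2
    · intro hz
      exact ⟨k ⟨z, hz⟩, hik ⟨z, hz⟩⟩
  · have hCtop : (LinearMap.range s).comap L.mkQ = ⊤ := by
      refine hsup _ (eq_top_iff.2 fun z _ ↦ ?_)
      obtain ⟨c, hc⟩ := L.mkQ_surjective (s (f z))
      have hfc : f c = f z := by
        have := LinearMap.congr_fun hs (f z)
        rw [LinearMap.comp_apply, ← hc] at this
        exact this
      refine Submodule.mem_sup.2 ⟨c, ⟨f z, hc.symm⟩, z - c, ?_, add_sub_cancel c z⟩
      rw [LinearMap.mem_ker, map_sub, hfc, sub_self]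
    have hxk : k ⟨x, hxf⟩ ≠ 0 := fun h0 ↦ hxg ((LinearMap.congr_fun hk ⟨x, hxf⟩).symm.trans h0)
    obtain ⟨y, hy⟩ : L.mkQ (x : P) ∈ LinearMap.range s :=
      (hCtop ▸ Submodule.mem_top : (x : P) ∈ (LinearMap.range s).comap L.mkQ)
    have hy0 : y = 0 := by
      have := LinearMap.congr_fun hs y
      rw [LinearMap.comp_apply, hy] at this
      exact this.symm.trans hxf
    rw [hy0, map_zero, eq_comm, Submodule.mkQ_apply, Submodule.Quotient.mk_eq_zero] at hy
    exact hxk ((hmemL ⟨x, hxf⟩).1 hy)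

theorem ExtPath.of_linearEquiv {S T : Type u} [AddCommGroup S] [Module A S] [AddCommGroup T]
    [Module A T] [IsSimpleModule A S] (e : S ≃ₗ[A] T) : ExtPath A S T :=
  ⟨0, fun _ ↦ S, fun _ ↦ inferInstance, fun _ ↦ inferInstance, fun _ ↦ inferInstance,
    ⟨.refl A S⟩, ⟨e⟩, fun i ↦ i.elim0⟩

theorem ExtPath.congr_left {S S' T : Type u} [AddCommGroup S] [Module A S] [AddCommGroup S']
    [Module A S'] [AddCommGroup T] [Module A T] (e : S ≃ₗ[A] S') (h : ExtPath A S' T) :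
    ExtPath A S T := by
  obtain ⟨n, M, _, _, hM, ⟨e₀⟩, eT, hext⟩ := h
  exact ⟨n, M, inferInstance, inferInstance, hM, ⟨e₀ ≪≫ₗ e.symm⟩, eT, hext⟩

theorem ExtPath.cons {S S' T : Type u} [AddCommGroup S] [Module A S] [AddCommGroup S']
    [Module A S'] [AddCommGroup T] [Module A T] [IsSimpleModule A S]
    (h : ExtOne A S S' ∨ ExtOne A S' S) (hp : ExtPath A S' T) : ExtPath A S T := by
  obtain ⟨n, M, _, _, hM, ⟨e₀⟩, eT, hext⟩ := hp
  let M' : Fin (n + 2) → ModuleCat.{u} A := Fin.cons (.of A S) fun i ↦ .of A (M i)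
  refine ⟨n + 1, fun i ↦ M' i, inferInstance, inferInstance, ?_, ⟨.refl A S⟩, eT, ?_⟩
  · exact Fin.cases ‹_› hM
  · refine Fin.cases ?_ hext
    exact h.imp (·.congr (.refl A S) e₀.symm) (·.congr e₀.symm (.refl A S))

theorem extPath_of_projective_chain [IsArtinianRing A]
    (hJ : ∀ a ∈ Ring.jacobson A, ∀ b ∈ Ring.jacobson A, a * b = 0)
    (T : Type u) [AddCommGroup T] [Module A T] [IsSimpleModule A T] (n : ℕ)
    (P : Fin (n + 1) → Type u) [∀ i, AddCommGroup (P i)] [∀ i, Module A (P i)]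
    [∀ i, Module.Finite A (P i)] [∀ i, Module.Projective A (P i)]
    (hP : ∀ i, IsIndecomposableModule A (P i))
    (hlast : IsProjectiveCover A (P (Fin.last n)) T)
    (hV : ∀ i : Fin n, ∃ (V : Type u) (_ : AddCommGroup V) (_ : Module A V),
      IsSimpleModule A V ∧ IsCompositionFactorOf A V (P i.castSucc) ∧
      IsCompositionFactorOf A V (P i.succ))
    (S : Type u) [AddCommGroup S] [Module A S] [IsSimpleModule A S]
    (h0 : IsProjectiveCover A (P 0) S) : ExtPath A S T := by
  induction n generalizing S with
  | zero =>
    obtain ⟨e⟩ := h0.nonempty_linearEquiv hlast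
    exact .of_linearEquiv e
  | succ n ih =>
    obtain ⟨S', _, _, _, hS'⟩ := (hP 1).exists_isProjectiveCover
    have hpath : ExtPath A S' T :=
      ih (fun i ↦ P i.succ) (fun i ↦ hP _) hlast (fun i ↦ hV i.succ) S' hS'
    obtain ⟨V, _, _, _, hVl, hVr⟩ := hV 0
    have hVpath : ExtPath A V T := by
      rcases hS'.nonempty_linearEquiv_or_extOne hJ hVr with ⟨⟨e⟩⟩ | h
      · exact hpath.congr_left e.symm
      · exact hpath.cons (.inr h)
    rcases h0.nonempty_linearEquiv_or_extOne hJ hVl with ⟨⟨e⟩⟩ | h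
    · exact hVpath.congr_left e
    · exact hVpath.cons (.inl h)

end

theorem unop_mem_jacobson_bot_of_mem {R : Type*} [Ring R] {x : Rᵐᵒᵖ}
    (hx : x ∈ Ring.jacobson Rᵐᵒᵖ) :
    x.unop ∈ (⊥ : TwoSidedIdeal R).jacobson := by
  have key : ∀ w ∈ Ring.jacobson Rᵐᵒᵖ, ∃ z, z * (1 + w) = 1 := by
    intro w hw
    rw [← Ideal.jacobson_bot] at hw
    obtain ⟨z, hz⟩ := Ideal.mem_jacobson_iff.1 hw 1
    refine ⟨z, sub_eq_zero.1 ?_⟩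
    rw [Ideal.mem_bot] at hz
    rw [← hz]; noncomm_ring
  have hunit : ∀ w ∈ Ring.jacobson Rᵐᵒᵖ, ∃ z, (1 + w) * z = 1 := by
    intro w hw
    obtain ⟨z, hz⟩ := key w hw
    have hzw : z = 1 + -(z * w) := by
      rw [← hz]; noncomm_ring
    obtain ⟨y, hy⟩ := key _ (neg_mem (Ideal.mul_mem_left _ z hw))
    rw [← hzw] at hy
    exact ⟨z, by rwa [left_inv_eq_right_inv hy hz] at hy⟩
  rw [TwoSidedIdeal.mem_jacobson_iff]
  intro y
  obtain ⟨z, hz⟩ := hunit _ (Ideal.mul_mem_right (.op y) _ hx)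
  refine ⟨z.unop, (TwoSidedIdeal.mem_bot R).2 ?_⟩
  have := congrArg MulOpposite.unop hz
  simp only [MulOpposite.unop_mul, MulOpposite.unop_add, MulOpposite.unop_one,
    MulOpposite.unop_op] at this
  rw [← sub_eq_zero.2 this]; noncomm_ring

/-- Let `R` be a right artinian ring with `J(R)² = 0` and let `S` and `T` be simple
right `R`-modules.  Then there is a sequence of finitely generated indecomposable
projective right `R`-modules from the projective cover of `S` to the projective
cover of `T` in which consecutive members have a common composition factor, if and
only if there is an Ext-path from `S` to `T`. -/
theorem projCover_chain_iff_extPath (R : Type u) [Ring R]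
    (hart : IsArtinianRing Rᵐᵒᵖ)
    (hJ2 : ∀ a b : R, a ∈ (⊥ : TwoSidedIdeal R).jacobson →
      b ∈ (⊥ : TwoSidedIdeal R).jacobson → a * b = 0)
    (S T : Type u) [AddCommGroup S] [Module Rᵐᵒᵖ S] [AddCommGroup T] [Module Rᵐᵒᵖ T]
    (hS : IsSimpleModule Rᵐᵒᵖ S) (hT : IsSimpleModule Rᵐᵒᵖ T) :
    (∃ (n : ℕ) (P : Fin (n + 1) → Type u)
      (_ : ∀ i, AddCommGroup (P i)) (_ : ∀ i, Module Rᵐᵒᵖ (P i)),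
        (∀ i, Module.Finite Rᵐᵒᵖ (P i)) ∧
        (∀ i, Module.Projective Rᵐᵒᵖ (P i)) ∧
        (∀ i, IsIndecomposableModule Rᵐᵒᵖ (P i)) ∧
        IsProjectiveCover Rᵐᵒᵖ (P 0) S ∧
        IsProjectiveCover Rᵐᵒᵖ (P (Fin.last n)) T ∧
        (∀ i : Fin n, ∃ (V : Type u) (_ : AddCommGroup V) (_ : Module Rᵐᵒᵖ V),
          IsSimpleModule Rᵐᵒᵖ V ∧
          IsCompositionFactorOf Rᵐᵒᵖ V (P i.castSucc) ∧
          IsCompositionFactorOf Rᵐᵒᵖ V (P i.succ)))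
      ↔ ExtPath Rᵐᵒᵖ S T := by
  have hJ : ∀ a ∈ Ring.jacobson Rᵐᵒᵖ, ∀ b ∈ Ring.jacobson Rᵐᵒᵖ, a * b = 0 := fun a ha b hb ↦
    MulOpposite.unop_injective
      (hJ2 _ _ (unop_mem_jacobson_bot_of_mem hb) (unop_mem_jacobson_bot_of_mem ha))
  constructor
  · rintro ⟨n, P, _, _, _, _, hP, h0, hlast, hV⟩
    exact extPath_of_projective_chain hJ T n P hP hlast hV S h0
  · rintro ⟨n, M, _, _, _, ⟨e₀⟩, ⟨e₁⟩, hext⟩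
    choose P _ _ hfin hcov using
      fun i ↦ exists_isProjectiveCover_of_isSimpleModule (A := Rᵐᵒᵖ) (M i)
    refine ⟨n, P, inferInstance, inferInstance, hfin, fun i ↦ (hcov i).1,
      fun i ↦ (hcov i).isIndecomposableModule, (hcov 0).congr e₀, (hcov _).congr e₁, fun i ↦ ?_⟩
    rcases hext i with h | h
    · exact ⟨M i.succ, inferInstance, inferInstance, inferInstance,
        h.isCompositionFactorOf (hcov _), (hcov _).isCompositionFactorOf⟩
    · exact ⟨M i.castSucc, inferInstance, inferInstance, inferInstance,
        (hcov _).isCompositionFactorOf, h.isCompositionFactorOf (hcov _)⟩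
end

section
/- Let R be a ring and let M and N be left R-modules. Suppose the characteristic of the endomorphism ring End_R(M) equals a and the characteristic of End_R(N) equals b, where a and b are positive integers that are coprime. Then Ext^1_R(N, M) = 0, i.e., every short exact sequence 0 → M → K → N → 0 of left R-modules splits. -/
universe u v

/-- A module is annihilated by the characteristic of its endomorphism ring. -/
theorem ringChar_end_nsmul {R M : Type*} [Ring R] [AddCommGroup M] [Module R M] (m : M) :
    ringChar (Module.End R M) • m = 0 := by
  rw [← Module.End.natCast_apply (R := R), ringChar.Nat.cast_ringChar, LinearMap.zero_apply]

/-- A surjection of modules splits if some integer annihilates its kernel and acts as the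
identity on its target. -/
theorem LinearMap.exists_section_of_zsmul {R K N : Type*} [Ring R] [AddCommGroup K] [Module R K]
    [AddCommGroup N] [Module R N] (p : K →ₗ[R] N) (hp : Function.Surjective p) (e : ℤ)
    (hker : ∀ x ∈ LinearMap.ker p, e • x = 0) (hN : ∀ y : N, e • y = y) :
    ∃ s : N →ₗ[R] K, p ∘ₗ s = LinearMap.id := by
  refine ⟨(LinearMap.ker p).liftQ (e • LinearMap.id) (fun x hx => by simpa using hker x hx) ∘ₗ
    (p.quotKerEquivOfSurjective hp).symm.toLinearMap, LinearMap.ext fun y => ?_⟩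
  obtain ⟨x, rfl⟩ := hp y
  have h : (p.quotKerEquivOfSurjective hp).symm (p x) = (LinearMap.ker p).mkQ x :=
    (LinearEquiv.symm_apply_eq _).2 rfl
  simp [h, hN]

/-- If `M` and `N` are left `R`-modules whose endomorphism rings have positive
coprime characteristics `a` and `b`, then `Ext¹_R(N, M) = 0`: every short exact
sequence `0 → M → K → N → 0` of left `R`-modules splits. -/
theorem ext_eq_zero_of_coprime_char (R : Type u) [Ring R]
    (M N : Type v) [AddCommGroup M] [Module R M] [AddCommGroup N] [Module R N]
    (a b : ℕ) (ha : 0 < a) (hb : 0 < b) (hab : Nat.Coprime a b)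
    (hcharM : ringChar (Module.End R M) = a)
    (hcharN : ringChar (Module.End R N) = b)
    (K : Type v) [AddCommGroup K] [Module R K]
    (i : M →ₗ[R] K) (p : K →ₗ[R] N)
    (hi : Function.Injective i) (hp : Function.Surjective p)
    (hexact : LinearMap.range i = LinearMap.ker p) :
    ∃ s : N →ₗ[R] K, p ∘ₗ s = LinearMap.id := by
  subst hcharM hcharN
  have hbez := Nat.gcd_eq_gcd_ab (ringChar (Module.End R M)) (ringChar (Module.End R N))
  rw [hab.gcd_eq_one, Nat.cast_one] at hbez
  refine LinearMap.exists_section_of_zsmul p hp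
    (Nat.gcdA (ringChar (Module.End R M)) (ringChar (Module.End R N)) *
      ringChar (Module.End R M)) (fun x hx => ?_) fun y => ?_
  · obtain ⟨m, rfl⟩ := hexact ▸ hx
    rw [mul_smul, natCast_zsmul, ← map_nsmul, ringChar_end_nsmul, map_zero, smul_zero]
  · rw [mul_comm, eq_sub_of_add_eq hbez.symm, sub_smul, one_smul, mul_comm, mul_smul,
      natCast_zsmul, ringChar_end_nsmul, smul_zero, sub_zero]
end

section
/- Let R be a ring, let M be a simple left R-module with char(M) = 0 (i.e., End_R(M) has characteristic 0), and let N be a left R-module with char(N) = b for some positive integer b. Then Ext^1_R(N, M) = 0, i.e., every short exact sequence 0 → M → K → N → 0 of left R-modules splits. -/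
universe u v

/-- If `b` acts bijectively on `M` and annihilates the cokernel of an injection `i : M → K`,
then `i` has a retraction. -/
theorem LinearMap.exists_leftInverse_of_nsmul_mem_range {R M K : Type*} [Ring R]
    [AddCommGroup M] [Module R M] [AddCommGroup K] [Module R K] {i : M →ₗ[R] K}
    (hi : Function.Injective i) {b : ℕ}
    (hb : Function.Bijective ((b : Module.End R M) : M → M))
    (hK : ∀ k : K, b • k ∈ LinearMap.range i) :
    ∃ r : K →ₗ[R] M, r ∘ₗ i = LinearMap.id := by
  let f : K →ₗ[R] M := (LinearEquiv.ofInjective i hi).symm.toLinearMap ∘ₗ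
    LinearMap.codRestrict (LinearMap.range i) (b • LinearMap.id) hK
  have hf (k : K) : i (f k) = b • k :=
    congrArg Subtype.val ((LinearEquiv.ofInjective i hi).apply_symm_apply ⟨b • k, hK k⟩)
  let e := LinearEquiv.ofBijective (b : Module.End R M) hb
  refine ⟨e.symm.toLinearMap ∘ₗ f, LinearMap.ext fun m ↦ e.injective (hi ?_)⟩
  have he : e m = b • m := Module.End.natCast_apply b m
  simp [hf, he]

/-- If `M` is a simple left `R`-module with `char(M) = 0` and `N` is a left
`R`-module with `char(N) = b` for a positive integer `b`, then `Ext¹_R(N, M) = 0`: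
every short exact sequence `0 → M → K → N → 0` of left `R`-modules splits. -/
theorem ext_eq_zero_of_char_zero_simple (R : Type u) [Ring R]
    (M N : Type v) [AddCommGroup M] [Module R M] [AddCommGroup N] [Module R N]
    (hM : IsSimpleModule R M)
    (hcharM : ringChar (Module.End R M) = 0)
    (b : ℕ) (hb : 0 < b)
    (hcharN : ringChar (Module.End R N) = b)
    (K : Type v) [AddCommGroup K] [Module R K]
    (i : M →ₗ[R] K) (p : K →ₗ[R] N)
    (hi : Function.Injective i) (hp : Function.Surjective p)
    (hexact : LinearMap.range i = LinearMap.ker p) :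
    ∃ s : N →ₗ[R] K, p ∘ₗ s = LinearMap.id := by
  have hbM : (b : Module.End R M) ≠ 0 := fun h ↦ by
    rw [ringChar.spec, hcharM, zero_dvd_iff] at h
    omega
  have hbN : (b : Module.End R N) = 0 := by rw [ringChar.spec, hcharN]
  have hK (k : K) : b • k ∈ LinearMap.range i := by
    rw [hexact, LinearMap.mem_ker, map_nsmul, ← Module.End.natCast_apply (R := R), hbN,
      LinearMap.zero_apply]
  have hr := LinearMap.exists_leftInverse_of_nsmul_mem_range hi
    (LinearMap.bijective_of_ne_zero hbM) hK
  have hex : Function.Exact i p := LinearMap.exact_iff.mpr hexact.symm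
  exact ((hex.split_tfae hi hp).out 0 1 :).mpr hr
end

section
/- Let R be a ring and let M and N be simple left R-modules such that char(M) = a for some positive integer a (i.e., End_R(M) has positive characteristic) and char(N) = 0 (i.e., End_R(N) has characteristic 0). Then Ext^1_R(N, M) = 0, i.e., every short exact sequence 0 → M → K → N → 0 of left R-modules splits. -/
universe u v

/-- If `M` and `N` are simple left `R`-modules with `char(M) = a` for a positive
integer `a` and `char(N) = 0`, then `Ext¹_R(N, M) = 0`: every short exact sequence
`0 → M → K → N → 0` of left `R`-modules splits. -/
theorem ext_eq_zero_of_simple_char_pos_char_zero (R : Type u) [Ring R]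
    (M N : Type v) [AddCommGroup M] [Module R M] [AddCommGroup N] [Module R N]
    (hM : IsSimpleModule R M) (hN : IsSimpleModule R N)
    (a : ℕ) (ha : 0 < a)
    (hcharM : ringChar (Module.End R M) = a)
    (hcharN : ringChar (Module.End R N) = 0)
    (K : Type v) [AddCommGroup K] [Module R K]
    (i : M →ₗ[R] K) (p : K →ₗ[R] N)
    (hi : Function.Injective i) (hp : Function.Surjective p)
    (hexact : LinearMap.range i = LinearMap.ker p) :
    ∃ s : N →ₗ[R] K, p ∘ₗ s = LinearMap.id := by
  have haM : ∀ m : M, a • m = 0 := fun m ↦ by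
    have h := congrArg (fun f : Module.End R M ↦ f m) (hcharM ▸ ringChar.Nat.cast_ringChar)
    simpa [Module.End.natCast_apply] using h
  have haN : (a : Module.End R N) ≠ 0 := fun h ↦ by
    have := (ringChar.spec (Module.End R N) a).1 h
    rw [hcharN, zero_dvd_iff] at this
    omega
  let e : N ≃ₗ[R] N := LinearEquiv.ofBijective _ (LinearMap.bijective_of_ne_zero haN)
  have he : ∀ x, e x = a • x := fun x ↦ Module.End.natCast_apply a x
  have hker : LinearMap.ker p ≤ LinearMap.ker (a : Module.End R K) := by
    rw [← hexact]
    rintro _ ⟨m, rfl⟩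
    rw [LinearMap.mem_ker, Module.End.natCast_apply, ← map_nsmul, haM, map_zero]
  -- Multiplication by `a` on `K` factors through `p`.
  let g : N →ₗ[R] K :=
    (LinearMap.ker p).liftQ (a : Module.End R K) hker ∘ₗ
      (p.quotKerEquivOfSurjective hp).symm.toLinearMap
  have hg : ∀ k, g (p k) = a • k := fun k ↦ by
    have h : (p.quotKerEquivOfSurjective hp).symm (p k) = Submodule.Quotient.mk k := by
      rw [LinearEquiv.symm_apply_eq]
      rfl
    simp only [g, LinearMap.comp_apply, LinearEquiv.coe_coe, h]
    exact Module.End.natCast_apply a k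
  refine ⟨g ∘ₗ e.symm.toLinearMap, LinearMap.ext fun n ↦ ?_⟩
  obtain ⟨k, hk⟩ := hp (e.symm n)
  rw [LinearMap.comp_apply, LinearMap.comp_apply, LinearEquiv.coe_coe, ← hk, hg, map_nsmul, hk,
    ← he, LinearEquiv.apply_symm_apply, LinearMap.id_apply]
end

section
/- Let R be an indecomposable semiperfect ring that is left noetherian and right noetherian. Then for any two simple right R-modules S and T, the endomorphism rings End_R(S) and End_R(T) have the same characteristic. -/
universe u

/-- A ring is semiperfect if `R/J(R)` is a semisimple ring and idempotents lift
modulo the Jacobson radical `J(R)`. -/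
def IsSemiperfectRing (R : Type u) [Ring R] : Prop :=
  IsSemisimpleRing ((⊥ : TwoSidedIdeal R).jacobson.ringCon.Quotient) ∧
  ∀ a : R, a * a - a ∈ (⊥ : TwoSidedIdeal R).jacobson →
    ∃ e : R, IsIdempotentElem e ∧ e - a ∈ (⊥ : TwoSidedIdeal R).jacobson

/-- A nonzero ring is indecomposable if its only central idempotents are `0` and `1`. -/
def IsIndecomposableRing (R : Type u) [Ring R] : Prop :=
  Nontrivial R ∧ ∀ e : R, IsIdempotentElem e → e ∈ Set.center R → e = 0 ∨ e = 1

theorem Ring.mem_jacobson_of_isUnit_one_add_mul {A : Type*} [Ring A] {x : A}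
    (h : ∀ y, IsUnit (1 + y * x)) : x ∈ Ring.jacobson A := by
  rw [← Ideal.jacobson_bot, Ideal.mem_jacobson_iff]
  intro y
  obtain ⟨z, hz⟩ := (h y).exists_left_inv
  refine ⟨z, ?_⟩
  rw [Ideal.mem_bot, ← hz]
  noncomm_ring

theorem TwoSidedIdeal.isUnit_one_add_of_mem_jacobson_bot {R : Type*} [Ring R] {x : R}
    (hx : x ∈ (⊥ : TwoSidedIdeal R).jacobson) : IsUnit (1 + x) := by
  have left_inv : ∀ w ∈ (⊥ : TwoSidedIdeal R).jacobson, ∃ z, z * (1 + w) = 1 := by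
    intro w hw
    obtain ⟨z, hz⟩ := TwoSidedIdeal.mem_jacobson_iff.mp hw 1
    rw [TwoSidedIdeal.mem_bot, sub_eq_zero] at hz
    exact ⟨z, by rw [mul_one] at hz; rw [mul_add, mul_one, add_comm, hz]⟩
  obtain ⟨z, hz⟩ := left_inv x hx
  obtain ⟨t, ht⟩ := left_inv (-(z * x))
    (TwoSidedIdeal.neg_mem _ (TwoSidedIdeal.mul_mem_left _ _ _ hx))
  have hz' : 1 + -(z * x) = z := by rw [← hz, mul_add, mul_one, add_neg_cancel_right]
  rw [hz'] at ht
  have htx : t = 1 + x := by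
    calc t = t * (z * (1 + x)) := by rw [hz, mul_one]
      _ = 1 + x := by rw [← mul_assoc, ht, one_mul]
  exact ⟨⟨1 + x, z, htx ▸ ht, hz⟩, rfl⟩

/-- If `n` lies in the radical on the corner of an idempotent `f` and is invertible on the
corner of `1 - f`, then Nakayama's lemma kills the Peirce component `f A (1 - f)`. -/
theorem IsIdempotentElem.mul_mul_one_sub_eq_zero {A : Type*} [Ring A] [IsNoetherianRing A]
    {f u : A} {n : ℕ} (hf : IsIdempotentElem f) (hn : (n : A) * f ∈ Ring.jacobson A)
    (hu : IsUnit (f + n * u)) (r : A) : f * r * (1 - f) = 0 := by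
  obtain ⟨v, hv⟩ := hu.exists_right_inv
  let L : Ideal A := Ideal.span (Set.range fun r : A ↦ f * r * (1 - f))
  have hgf : (1 - f) * f = 0 := by rw [sub_mul, one_mul, hf.eq, sub_self]
  have hgg : (1 - f) * (1 - f) = 1 - f := hf.one_sub.eq
  have hL : L ≤ Ring.jacobson A • L := by
    refine Ideal.span_le.mpr ?_
    rintro _ ⟨r, rfl⟩
    have key : f * r * (1 - f) =
        ((n : A) * f) • (f * (r * (1 - f) * u * v) * (1 - f)) := by
      calc f * r * (1 - f) = f * r * (1 - f) * ((f + n * u) * v) * (1 - f) := by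
            rw [hv, mul_one, mul_assoc _ (1 - f) (1 - f), hgg]
        _ = f * r * ((1 - f) * f) * v * (1 - f) +
            f * r * (1 - f) * n * u * v * (1 - f) := by noncomm_ring
        _ = n * (f * r * (1 - f)) * u * v * (1 - f) := by
            rw [hgf, (Nat.cast_commute n (f * r * (1 - f))).eq]; simp
        _ = n * ((f * f) * r * (1 - f)) * u * v * (1 - f) := by rw [hf.eq]
        _ = _ := by simp only [smul_eq_mul, mul_assoc]
    change f * r * (1 - f) ∈ Ring.jacobson A • L
    rw [key]
    exact Submodule.smul_mem_smul hn (Ideal.subset_span ⟨_, rfl⟩)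
  have hbot : L = ⊥ := (IsNoetherian.noetherian L).eq_bot_of_le_jacobson_smul hL
  have hmem : f * r * (1 - f) ∈ L := Ideal.subset_span ⟨r, rfl⟩
  rwa [hbot] at hmem

/-- In a semiperfect ring every natural number is radical on one Peirce corner and invertible
on the complementary one. -/
theorem IsSemiperfectRing.exists_idempotent {R : Type*} [Ring R] (h : IsSemiperfectRing R)
    (n : ℕ) : ∃ f u : R, IsIdempotentElem f ∧
      (n : R) * f ∈ (⊥ : TwoSidedIdeal R).jacobson ∧ IsUnit (f + n * u) := by
  obtain ⟨hss, hlift⟩ := h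
  set J := (⊥ : TwoSidedIdeal R).jacobson
  have hmk : ∀ a b : R, (a : J.ringCon.Quotient) = b ↔ a - b ∈ J := fun a b ↦
    J.ringCon.eq.trans (J.rel_iff a b)
  obtain ⟨e, he, hspan⟩ := IsSemisimpleRing.ideal_eq_span_idempotent
    (Ideal.span {(n : J.ringCon.Quotient)})
  obtain ⟨c, hc⟩ := Ideal.mem_span_singleton'.mp (hspan ▸ Ideal.mem_span_singleton_self e)
  obtain ⟨d, hd⟩ := Ideal.mem_span_singleton'.mp
    (hspan.symm ▸ Ideal.mem_span_singleton_self (n : J.ringCon.Quotient))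
  have hne : (n : J.ringCon.Quotient) * e = n := by rw [← hd, mul_assoc, he.eq]
  obtain ⟨a, rfl⟩ := Quotient.exists_rep e
  obtain ⟨u, rfl⟩ := Quotient.exists_rep c
  change IsIdempotentElem (a : J.ringCon.Quotient) at he
  change (n : J.ringCon.Quotient) * (a : J.ringCon.Quotient) = n at hne
  change (u : J.ringCon.Quotient) * (n : J.ringCon.Quotient) = (a : J.ringCon.Quotient) at hc
  obtain ⟨f, hf, hfa⟩ := hlift (1 - a) ((hmk _ _).mp (by
    push_cast
    exact he.one_sub.eq))
  have hfa' : (f : J.ringCon.Quotient) = 1 - a := by simpa using (hmk _ _).mpr hfa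
  refine ⟨f, u, hf, ?_, ?_⟩
  · rw [← sub_zero ((n : R) * f)]
    refine (hmk _ _).mp ?_
    push_cast
    rw [hfa', mul_sub, mul_one, hne, sub_self]
  · have hmem : f + n * u - 1 ∈ J := by
      refine (hmk _ _).mp ?_
      push_cast
      rw [hfa', (Nat.cast_commute n (u : J.ringCon.Quotient)).eq, hc, sub_add_cancel]
    simpa using TwoSidedIdeal.isUnit_one_add_of_mem_jacobson_bot hmem

theorem natCast_mem_jacobson_op_or_isUnit {R : Type*} [Ring R]
    (hsp : IsSemiperfectRing R) (hln : IsNoetherianRing R) (hrn : IsNoetherianRing Rᵐᵒᵖ)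
    (hind : IsIndecomposableRing R) (n : ℕ) :
    (n : Rᵐᵒᵖ) ∈ Ring.jacobson Rᵐᵒᵖ ∨ IsUnit (n : Rᵐᵒᵖ) := by
  obtain ⟨f, u, hf, hnf, hu⟩ := hsp.exists_idempotent n
  have hnf' : (n : Rᵐᵒᵖ) * MulOpposite.op f ∈ Ring.jacobson Rᵐᵒᵖ := by
    refine Ring.mem_jacobson_of_isUnit_one_add_mul fun y ↦ ?_
    have h := TwoSidedIdeal.isUnit_one_add_of_mem_jacobson_bot
      (TwoSidedIdeal.mul_mem_right _ _ y.unop hnf)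
    have heq : 1 + y * ((n : Rᵐᵒᵖ) * MulOpposite.op f) =
        MulOpposite.op (1 + n * f * y.unop) := by
      simp [(Nat.cast_commute n f).eq]
    exact heq ▸ h.op
  have hu' : IsUnit (MulOpposite.op f + (n : Rᵐᵒᵖ) * MulOpposite.op u) := by
    convert hu.op using 1
    simp [(Nat.cast_commute n u).eq]
  have h₁ := hf.mul_mul_one_sub_eq_zero (Ring.mem_jacobson_of_isUnit_one_add_mul fun y ↦
    TwoSidedIdeal.isUnit_one_add_of_mem_jacobson_bot (TwoSidedIdeal.mul_mem_left _ y _ hnf)) hu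
  have hfop : IsIdempotentElem (MulOpposite.op f) := congrArg MulOpposite.op hf.eq
  have h₂ : ∀ r : R, (1 - f) * r * f = 0 := fun r ↦ by
    have h := congrArg MulOpposite.unop
      (hfop.mul_mul_one_sub_eq_zero hnf' hu' (MulOpposite.op r))
    simpa [mul_assoc] using h
  have hcenter : f ∈ Set.center R := by
    rw [Semigroup.mem_center_iff]
    intro r
    have h₁r := h₁ r
    have h₂r := h₂ r
    rw [mul_sub, mul_one, sub_eq_zero] at h₁r
    rw [sub_mul, sub_mul, one_mul, sub_eq_zero] at h₂r
    exact h₂r.trans h₁r.symm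
  rcases hind.2 f hf hcenter with rfl | rfl
  · right
    simp only [MulOpposite.op_zero, zero_add] at hu'
    exact ((Nat.cast_commute n (MulOpposite.op u)).isUnit_mul_iff.mp hu').1
  · left
    simpa using hnf'

theorem natCast_end_eq_zero_iff_mem_jacobson {A M : Type*} [Ring A] [AddCommGroup M] [Module A M]
    [IsSimpleModule A M] {n : ℕ} (h : (n : A) ∈ Ring.jacobson A ∨ IsUnit (n : A)) :
    (n : Module.End A M) = 0 ↔ (n : A) ∈ Ring.jacobson A := by
  have hsmul : ∀ m : M, (n : Module.End A M) m = (n : A) • m := fun m ↦ by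
    rw [Module.End.natCast_apply, Nat.cast_smul_eq_nsmul]
  constructor
  · intro h0
    refine h.resolve_right fun hunit ↦ ?_
    have := IsSimpleModule.nontrivial A M
    obtain ⟨m, hm⟩ := exists_ne (0 : M)
    exact hm (hunit.smul_eq_zero.mp (by rw [← hsmul, h0, LinearMap.zero_apply]))
  · intro hmem
    ext m
    rw [hsmul, LinearMap.zero_apply]
    exact Module.mem_annihilator.mp (IsSemisimpleModule.jacobson_le_annihilator A M hmem) m

/-- Over an indecomposable semiperfect left and right noetherian ring, the
endomorphism rings of any two simple right modules have the same characteristic. -/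
theorem char_end_eq_of_indecomposable (R : Type u) [Ring R]
    (hsp : IsSemiperfectRing R)
    (hln : IsNoetherianRing R) (hrn : IsNoetherianRing Rᵐᵒᵖ)
    (hind : IsIndecomposableRing R)
    (S T : Type u) [AddCommGroup S] [Module Rᵐᵒᵖ S] [AddCommGroup T] [Module Rᵐᵒᵖ T]
    (hS : IsSimpleModule Rᵐᵒᵖ S) (hT : IsSimpleModule Rᵐᵒᵖ T) :
    ringChar (Module.End Rᵐᵒᵖ S) = ringChar (Module.End Rᵐᵒᵖ T) := by
  have hiff : ∀ n : ℕ, (n : Module.End Rᵐᵒᵖ S) = 0 ↔ (n : Module.End Rᵐᵒᵖ T) = 0 := fun n ↦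
    have h := natCast_mem_jacobson_op_or_isUnit hsp hln hrn hind n
    (natCast_end_eq_zero_iff_mem_jacobson h).trans (natCast_end_eq_zero_iff_mem_jacobson h).symm
  exact Nat.dvd_antisymm (ringChar.dvd ((hiff _).mpr (ringChar.Nat.cast_ringChar)))
    (ringChar.dvd ((hiff _).mp (ringChar.Nat.cast_ringChar)))
end

section
/- Let R be an indecomposable semiperfect ring that is left noetherian and right noetherian, and suppose there exists a finite simple right R-module. Then every right R-module of finite length is finite. -/
universe u

open MulOpposite

section Preliminaries

variable {R : Type u} [Ring R]

/-- A finitely generated submodule has finite image under an additive map which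
factors through the action of a finite ring. -/
theorem finite_image_of_fg_of_map_smul_eq_zero {A M H S : Type*} [Ring A] [AddCommGroup M]
    [Module A M] [AddCommGroup H] [Ring S] [Finite S] (φ : A →+* S) (N : Submodule A M)
    (hN : N.FG) (f : M →+ H) (hf : ∀ n ∈ N, ∀ r, φ r = 0 → f (r • n) = 0) :
    (f '' N).Finite := by
  obtain ⟨k, v, hv⟩ := Submodule.fg_iff_exists_fin_generating_family.1 hN
  have hvN i : v i ∈ N := hv ▸ Submodule.subset_span ⟨i, rfl⟩
  refine (Set.finite_range fun c : Fin k → φ.range ↦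
    f (∑ i, (c i).2.choose • v i)).subset ?_
  rintro _ ⟨n, hn, rfl⟩
  rw [SetLike.mem_coe, ← hv, Submodule.mem_span_range_iff_exists_fun] at hn
  obtain ⟨c, rfl⟩ := hn
  refine ⟨fun i ↦ ⟨φ (c i), c i, rfl⟩, ?_⟩
  simp only [map_sum]
  refine Finset.sum_congr rfl fun i _ ↦ ?_
  rw [← sub_eq_zero, ← map_sub, ← sub_smul]
  apply hf _ (hvN i)
  generalize_proofs h
  rw [map_sub, h.choose_spec, sub_self]

theorem finite_of_fg_of_smul_eq_zero {A M S : Type*} [Ring A] [AddCommGroup M]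
    [Module A M] [Module.Finite A M] [Ring S] [Finite S] (φ : A →+* S)
    (h : ∀ r, φ r = 0 → ∀ m : M, r • m = 0) : Finite M := by
  have := finite_image_of_fg_of_map_smul_eq_zero φ (⊤ : Submodule A M) Module.Finite.fg_top
    (AddMonoidHom.id M) fun n _ r hr ↦ h r hr n
  simpa [Set.finite_univ_iff] using this

instance finite_mulOpposite (α : Type*) [Finite α] : Finite αᵐᵒᵖ :=
  Finite.of_equiv α opEquiv

instance finite_addMonoidEnd (M : Type*) [AddCommMonoid M] [Finite M] :
    Finite (AddMonoid.End M) :=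
  Finite.of_injective (fun f : AddMonoid.End M ↦ (f : M → M)) DFunLike.coe_injective

instance isNoetherian_mulOpposite_self [IsNoetherianRing Rᵐᵒᵖ] : IsNoetherian Rᵐᵒᵖ R :=
  isNoetherian_of_surjective (LinearMap.toSpanSingleton Rᵐᵒᵖ R 1)
    (LinearMap.range_eq_top.2 fun x ↦ ⟨op x, by simp⟩)

instance isNoetherianRing_mulOpposite_mulOpposite [IsNoetherianRing R] :
    IsNoetherianRing Rᵐᵒᵖᵐᵒᵖ :=
  isNoetherianRing_of_ringEquiv R (RingEquiv.opOp R)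

theorem exists_mul_one_add_of_mem_jacobson {x : R} (hx : x ∈ Ring.jacobson R) :
    ∃ s, s * (1 + x) = 1 := by
  rw [← Ideal.jacobson_bot] at hx
  obtain ⟨s, hs⟩ := Ideal.exists_mul_add_sub_mem_of_mem_jacobson x hx
  exact ⟨s, by rw [add_comm]; exact sub_eq_zero.1 hs⟩

theorem isUnit_one_add_of_mem_jacobson {x : R} (hx : x ∈ Ring.jacobson R) :
    IsUnit (1 + x) := by
  obtain ⟨s, hs⟩ := exists_mul_one_add_of_mem_jacobson hx
  obtain ⟨t, ht⟩ := exists_mul_one_add_of_mem_jacobson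
    (neg_mem (Ideal.mul_mem_left _ s hx) : -(s * x) ∈ Ring.jacobson R)
  have : 1 + -(s * x) = s := by rw [← hs]; noncomm_ring
  rw [this] at ht
  have h : t = 1 + x := by
    calc t = t * (s * (1 + x)) := by rw [hs, mul_one]
      _ = 1 + x := by rw [← mul_assoc, ht, one_mul]
  exact ⟨⟨1 + x, s, h ▸ ht, hs⟩, rfl⟩

theorem op_mem_jacobson {x : R} (hx : x ∈ Ring.jacobson R) :
    op x ∈ Ring.jacobson Rᵐᵒᵖ := by
  rw [← Ideal.jacobson_bot, Ideal.mem_jacobson_iff]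
  intro y
  obtain ⟨u, hu⟩ := isUnit_one_add_of_mem_jacobson
    (Ideal.mul_mem_right y.unop (Ring.jacobson R) hx)
  refine ⟨op ↑u⁻¹, unop_injective ?_⟩
  have : x * (unop y * ↑u⁻¹) + ↑u⁻¹ = (1 : R) := by
    calc _ = (1 + x * unop y) * (↑u⁻¹ : R) := by noncomm_ring
      _ = 1 := by rw [← hu, u.mul_inv]
  simp [this]

theorem mem_jacobson_smul_eq_zero {M : Type*} [AddCommGroup M] [Module R M]
    [IsSimpleModule R M] {x : R} (hx : x ∈ Ring.jacobson R) (m : M) : x • m = 0 := by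
  have h := Ring.jacobson_smul_top_le R M (Submodule.smul_mem_smul hx (Submodule.mem_top (x := m)))
  simpa [IsSemisimpleModule.jacobson_eq_bot] using h

end Preliminaries

section Ideals

variable {R : Type u} [Ring R]

/-- A two-sided Nakayama lemma. -/
theorem eq_bot_of_le_mul_sup_mul [IsNoetherianRing R] [IsNoetherianRing Rᵐᵒᵖ]
    {J U : Ideal R} [J.IsTwoSided] [U.IsTwoSided] (hJ : J ≤ Ring.jacobson R)
    (h : U ≤ J * U ⊔ U * J) : U = ⊥ := by
  have hU : U ≤ U * J := by
    have : Submodule.map (Submodule.mkQ (U * J)) U = ⊥ := by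
      refine Submodule.FG.eq_bot_of_le_jacobson_smul ((IsNoetherian.noetherian U).map _) ?_
      calc _ ≤ Submodule.map (Submodule.mkQ (U * J)) (J * U ⊔ U * J) := Submodule.map_mono h
        _ ≤ Submodule.map (Submodule.mkQ (U * J)) (J • U) := by
          rw [Submodule.map_sup, Submodule.mkQ_map_self, sup_bot_eq, smul_eq_mul]
        _ ≤ _ := by
          rw [Submodule.map_smul'']
          exact Submodule.smul_mono_left hJ
    exact fun x hx ↦ (Submodule.Quotient.mk_eq_zero _).1
      ((Submodule.mem_bot R).1 (this ▸ Submodule.mem_map_of_mem hx))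
  let U' : Submodule Rᵐᵒᵖ R :=
    { U.toAddSubmonoid with smul_mem' := fun c x hx ↦ Ideal.mul_mem_right _ U hx }
  have hU' : U' = ⊥ := by
    refine Submodule.FG.eq_bot_of_le_jacobson_smul (IsNoetherian.noetherian U') fun x hx ↦ ?_
    have hx' : x ∈ U * J := hU hx
    clear hx
    induction hx' using Submodule.mul_induction_on' with
    | mem_mul_mem a ha b hb =>
      exact Submodule.smul_mem_smul (op_mem_jacobson (hJ hb)) (show a ∈ U' from ha)
    | add a _ b _ ha hb => exact add_mem ha hb
  refine (Submodule.eq_bot_iff _).2 fun x hx ↦ ?_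
  simpa [hU'] using (show x ∈ U' from hx)

theorem mul_mul_one_sub_mem_mul_self [IsNoetherianRing Rᵐᵒᵖ] {J : Ideal R} [J.IsTwoSided] {e : R}
    (he : IsIdempotentElem e) (hcomm : ∀ r, e * r - r * e ∈ J) {S : Type u} [Ring S] [Finite S]
    (φ : R →+* S) (hφ : ∀ x, φ x = 0 → x * (1 - e) ∈ J)
    (hfin : ∀ (T : Type u) [Ring T] [Finite T] (ψ : R →+* T), (∀ x ∈ J, ψ x = 0) → ψ e = 0)
    {x : R} (hx : x ∈ J) : e * x * (1 - e) ∈ J * J := by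
  let N' : Submodule Rᵐᵒᵖ R :=
    { carrier := {x | x ∈ J ∧ x * e ∈ J * J}
      zero_mem' := by simp
      add_mem' := fun ha hb ↦ ⟨add_mem ha.1 hb.1, by rw [add_mul]; exact add_mem ha.2 hb.2⟩
      smul_mem' := fun c a ha ↦ ⟨Ideal.mul_mem_right _ J ha.1, by
        have h1 := Ideal.mul_mem_right c.unop _ ha.2
        have h2 := Ideal.mul_mem_mul ha.1 (hcomm c.unop)
        have : a * c.unop * e = a * e * c.unop - a * (e * c.unop - c.unop * e) := by noncomm_ring
        change a * c.unop * e ∈ _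
        rw [this]
        exact sub_mem h1 h2⟩ }
  let N : Ideal R :=
    { N'.toAddSubmonoid with
      smul_mem' := fun c a ha ↦ ⟨Ideal.mul_mem_left _ c ha.1, by
        rw [smul_eq_mul, mul_assoc]; exact Ideal.mul_mem_left _ c ha.2⟩ }
  let L := Submodule.map (Submodule.mkQ (J * J)) N
  have : Finite L := by
    have := finite_image_of_fg_of_map_smul_eq_zero φ.op N' (IsNoetherian.noetherian N')
      (Submodule.mkQ (J * J)).toAddMonoidHom fun n hn r hr ↦ by
        have hr' : φ r.unop = 0 := op_injective hr
        change Submodule.mkQ (J * J) (n * r.unop) = 0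
        rw [Submodule.mkQ_apply, Submodule.Quotient.mk_eq_zero]
        have h1 := Ideal.mul_mem_right r.unop _ hn.2
        have h2 := Ideal.mul_mem_mul hn.1 (hcomm r.unop)
        have h3 := Ideal.mul_mem_mul hn.1 (hφ _ hr')
        have : n * r.unop = n * e * r.unop - n * (e * r.unop - r.unop * e)
          + n * (r.unop * (1 - e)) := by noncomm_ring
        rw [this]
        exact add_mem (sub_mem h1 h2) h3
    exact this.to_subtype
  have hL := hfin (AddMonoid.End L) (Module.toAddMonoidEnd R L) fun a ha ↦ by
    refine AddMonoidHom.ext ?_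
    rintro ⟨_, n, hn, rfl⟩
    exact Subtype.ext ((Submodule.Quotient.mk_eq_zero _).2 (Ideal.mul_mem_mul ha hn.1))
  have hxN : x * (1 - e) ∈ N := by
    refine ⟨Ideal.mul_mem_right _ J hx, ?_⟩
    rw [mul_assoc, sub_mul, one_mul, he.eq, sub_self, mul_zero]
    exact zero_mem _
  have := DFunLike.congr_fun hL ⟨_, _, hxN, rfl⟩
  rw [mul_assoc, ← smul_eq_mul (a := e), ← Submodule.Quotient.mk_eq_zero]
  exact congr_arg Subtype.val this

theorem mul_mul_one_sub_eq_zero_of_mem_mul_self [IsNoetherianRing R] [IsNoetherianRing Rᵐᵒᵖ]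
    {J : Ideal R} [J.IsTwoSided] (hJ : J ≤ Ring.jacobson R) {e : R} (he : IsIdempotentElem e)
    (hcomm : ∀ r, e * r - r * e ∈ J) (h : ∀ x ∈ J, e * x * (1 - e) ∈ J * J) (r : R) :
    e * r * (1 - e) = 0 := by
  let U : Ideal R := Ideal.span {a | ∃ r b, a = e * r * (1 - e) * b}
  have hgen r b : e * r * (1 - e) * b ∈ U := Ideal.subset_span ⟨r, b, rfl⟩
  have hgen' r : e * r * (1 - e) ∈ U := by simpa using hgen r 1
  have : U.IsTwoSided := ⟨fun {a} c ha ↦ by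
    induction ha using Submodule.span_induction with
    | mem a ha =>
      obtain ⟨r, b, rfl⟩ := ha
      rw [mul_assoc]
      exact hgen _ _
    | zero => simp
    | add a b _ _ ha hb => rw [add_mul]; exact add_mem ha hb
    | smul d a _ ha => rw [smul_eq_mul, mul_assoc]; exact Ideal.mul_mem_left _ d ha⟩
  have hsq : ∀ y ∈ J * J, e * y * (1 - e) ∈ J * U ⊔ U * J := fun y hy ↦ by
    induction hy using Submodule.mul_induction_on' with
    | mem_mul_mem a ha b hb =>
      have : e * (a * b) * (1 - e) =
        (e * a) * (e * b * (1 - e)) + (e * a * (1 - e)) * (b * (1 - e)) := by noncomm_ring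
      rw [this]
      exact add_mem
        (Ideal.mem_sup_left (Ideal.mul_mem_mul (Ideal.mul_mem_left _ _ ha) (hgen' _)))
        (Ideal.mem_sup_right (Ideal.mul_mem_mul (hgen' _) (Ideal.mul_mem_right _ _ hb)))
    | add a _ b _ ha hb => rw [mul_add, add_mul]; exact add_mem ha hb
  have he' : (1 - e) * (1 - e) = 1 - e := he.one_sub.eq
  have hU : U = ⊥ := by
    refine eq_bot_of_le_mul_sup_mul hJ (Ideal.span_le.2 ?_)
    rintro _ ⟨r, b, rfl⟩
    have hre : e * r * (1 - e) ∈ J := by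
      have : e * r * (1 - e) = (e * r - r * e) * (1 - e) := by
        have : e * (1 - e) = 0 := by rw [mul_sub, mul_one, he.eq, sub_self]
        rw [sub_mul, mul_assoc r, this, mul_zero, sub_zero]
      rw [this]
      exact Ideal.mul_mem_right _ _ (hcomm r)
    have heq : e * (e * r * (1 - e)) * (1 - e) = e * r * (1 - e) := by
      rw [mul_assoc, mul_assoc _ (1 - e), he', ← mul_assoc, ← mul_assoc, he.eq]
    have hre2 := h _ hre
    rw [heq] at hre2
    have := hsq _ hre2
    rw [heq] at this
    obtain ⟨p, hp, q, hq, hpq⟩ := Submodule.mem_sup.1 this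
    rw [SetLike.mem_coe, ← hpq, add_mul]
    exact add_mem (Ideal.mem_sup_left (Ideal.mul_mem_right _ _ hp))
      (Ideal.mem_sup_right (Ideal.mul_mem_right _ _ hq))
  simpa [hU] using hgen' r

theorem mul_mul_one_sub_eq_zero [IsNoetherianRing R] [IsNoetherianRing Rᵐᵒᵖ]
    {Q : Type*} [Ring Q] (π : R →+* Q) (hπ : ∀ x, π x = 0 → x ∈ Ring.jacobson R) {e : R}
    (he : IsIdempotentElem e) (hcomm : ∀ r, π e * π r = π r * π e)
    {S : Type u} [Ring S] [Finite S]
    (φ : R →+* S) (hφ : ∀ x, φ x = 0 → π (x * (1 - e)) = 0)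
    (hfin : ∀ (T : Type u) [Ring T] [Finite T] (ψ : R →+* T),
      (∀ x, π x = 0 → ψ x = 0) → ψ e = 0) (r : R) :
    e * r * (1 - e) = 0 := by
  have hcomm' r : e * r - r * e ∈ RingHom.ker π := by simp [RingHom.mem_ker, hcomm]
  exact mul_mul_one_sub_eq_zero_of_mem_mul_self (J := RingHom.ker π) hπ he hcomm'
    (fun x hx ↦ mul_mul_one_sub_mem_mul_self he hcomm' φ hφ hfin hx) r

/-- An idempotent is central if it is central modulo the Jacobson radical and, modulo the radical,
it generates the smallest ideal with finite quotient. -/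
theorem mem_center_of_finite_quotients [IsNoetherianRing R] [IsNoetherianRing Rᵐᵒᵖ]
    {Q : Type*} [Ring Q] (π : R →+* Q) (hπ : ∀ x, π x = 0 → x ∈ Ring.jacobson R) {e : R}
    (he : IsIdempotentElem e) (hcomm : ∀ r, π e * π r = π r * π e)
    {S : Type u} [Ring S] [Finite S]
    (φ : R →+* S) (hφ : ∀ x, φ x = 0 → π (x * (1 - e)) = 0)
    (hfin : ∀ (T : Type u) [Ring T] [Finite T] (ψ : R →+* T),
      (∀ x, π x = 0 → ψ x = 0) → ψ e = 0) :
    e ∈ Set.center R := by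
  have h1 := mul_mul_one_sub_eq_zero π hπ he hcomm φ hφ hfin
  have h2 (r : R) : (1 - e) * r * e = 0 := by
    have := mul_mul_one_sub_eq_zero (R := Rᵐᵒᵖ) (e := op e) π.op
      (fun x hx ↦ op_mem_jacobson (hπ x.unop (op_injective hx)))
      (unop_injective he) (fun r ↦ unop_injective (hcomm r.unop).symm) φ.op
      (fun x hx ↦ unop_injective <| by
        have := hφ x.unop (op_injective hx)
        simp only [map_mul, map_sub, map_one] at this
        simp [sub_mul, hcomm]
        simpa [mul_sub] using this)
      (fun T _ _ ψ hψ ↦ congr_arg unop (hfin Tᵐᵒᵖ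
        ((RingHom.op ψ).comp (RingEquiv.opOp R).toRingHom)
        fun x hx ↦ unop_injective (hψ (op x) (unop_injective hx)))) (op r)
    have := congr_arg unop this
    simpa [mul_assoc] using this
  refine Semigroup.mem_center_iff.2 fun r ↦ ?_
  have h1 := h1 r
  have h2 := h2 r
  rw [mul_sub, mul_one, sub_eq_zero] at h1
  rw [sub_mul, one_mul, sub_mul, sub_eq_zero] at h2
  rw [h1, h2]

end Ideals

/-- A semisimple ring has a largest finite quotient, which is the quotient by an ideal generated by
a central idempotent. -/
theorem IsSemisimpleRing.exists_central_idempotent (Q : Type u) [Ring Q] [IsSemisimpleRing Q] :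
    ∃ (g : Q) (S : Type u) (_ : Ring S) (_ : Finite S) (φ : Q →+* S), IsIdempotentElem g ∧
      (∀ q, g * q = q * g) ∧ (∀ q, φ q = 0 → q * (1 - g) = 0) ∧
      ∀ (T : Type u) [Ring T] [Finite T] (ψ : Q →+* T), ψ g = 0 := by
  classical
  obtain ⟨n, D, d, _, hd, ⟨E⟩⟩ := IsSemisimpleRing.exists_ringEquiv_pi_matrix_divisionRing Q
  let P := Π i, Matrix (Fin (d i)) (Fin (d i)) (D i)
  let S := Π i : {i // Finite (D i)}, Matrix (Fin (d i)) (Fin (d i)) (D i)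
  have hS : Finite S := by
    have (i : {i // Finite (D i)}) : Finite (Matrix (Fin (d i)) (Fin (d i)) (D i)) :=
      have := i.2
      inferInstanceAs (Finite (Fin (d i) → Fin (d i) → D i))
    exact Pi.finite
  let φ : P →+* S := RingHom.pi fun i ↦ Pi.evalRingHom _ i.1
  let g : P := fun i ↦ if Finite (D i) then 0 else 1
  have key (T : Type u) [Ring T] [Finite T] (ψ : P →+* T) : ψ g = 0 := by
    have hg : g = ∑ i, Pi.single i (g i) := (Finset.univ_sum_single g).symm
    rw [hg, map_sum]
    refine Finset.sum_eq_zero fun i _ ↦ ?_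
    by_cases hi : Finite (D i)
    · simp [g, hi]
    simp only [g, hi, if_false]
    by_contra hne
    refine hi (Finite.of_injective
      (fun x ↦ ψ (Pi.single i (Matrix.scalar (Fin (d i)) x))) fun x y hxy ↦ ?_)
    by_contra hxy'
    apply hne
    have h0 : ψ (Pi.single i (Matrix.scalar (Fin (d i)) (x - y))) = 0 := by
      rw [map_sub, Pi.single_sub, map_sub]
      exact sub_eq_zero.2 hxy
    have h1 : (Pi.single i 1 : P) = Pi.single i (Matrix.scalar (Fin (d i)) (x - y)) *
        Pi.single i (Matrix.scalar (Fin (d i)) (x - y)⁻¹) := by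
      rw [← Pi.single_mul, ← map_mul, mul_inv_cancel₀ (sub_ne_zero.2 hxy'), map_one]
    rw [h1, map_mul, h0, zero_mul]
  refine ⟨E.symm g, S, inferInstance, hS, φ.comp E.toRingHom, ?_, fun q ↦ ?_, fun q hq ↦ ?_,
    fun T _ _ ψ ↦ key T (ψ.comp E.symm.toRingHom)⟩
  · apply E.injective
    rw [map_mul, E.apply_symm_apply]
    ext1 i
    by_cases hi : Finite (D i) <;> simp [g, hi]
  · apply E.injective
    rw [map_mul, map_mul, E.apply_symm_apply]
    ext1 i
    by_cases hi : Finite (D i) <;> simp [g, hi]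
  · apply E.injective
    rw [map_mul, map_sub, E.apply_symm_apply, map_one, map_zero]
    ext1 i
    by_cases hi : Finite (D i)
    · have : E q i = 0 := congr_fun hq ⟨i, hi⟩
      simp [this]
    · simp [g, hi]

/-- If an indecomposable semiperfect left and right noetherian ring has a finite
simple right module, then every right module of finite length is finite. -/
theorem finite_of_finiteLength_of_exists_finite_simple (R : Type u) [Ring R]
    (hsp : IsSemiperfectRing R)
    (hln : IsNoetherianRing R) (hrn : IsNoetherianRing Rᵐᵒᵖ)
    (hind : IsIndecomposableRing R)
    (hfin : ∃ (S : Type u) (_ : AddCommGroup S) (_ : Module Rᵐᵒᵖ S),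
      IsSimpleModule Rᵐᵒᵖ S ∧ Finite S) :
    ∀ (M : Type u) (_ : AddCommGroup M) (_ : Module Rᵐᵒᵖ M),
      IsFiniteLength Rᵐᵒᵖ M → Finite M := by
  have hJ (x : R) : x ∈ (⊥ : TwoSidedIdeal R).jacobson ↔ x ∈ Ring.jacobson R := by
    rw [← Ideal.jacobson_bot, Ideal.mem_jacobson_iff, TwoSidedIdeal.mem_jacobson_iff]
    simp
  obtain ⟨hss, hlift⟩ := hsp
  let π : R →+* (⊥ : TwoSidedIdeal R).jacobson.ringCon.Quotient := RingCon.mk' _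
  have hπs : Function.Surjective π := RingCon.mk'_surjective _
  have hπ (x : R) : π x = 0 ↔ x ∈ (⊥ : TwoSidedIdeal R).jacobson := by
    rw [TwoSidedIdeal.mem_iff]
    exact RingCon.eq _
  obtain ⟨g, S, _, _, φ, hg, hgc, hφ, hψ⟩ := IsSemisimpleRing.exists_central_idempotent
    (⊥ : TwoSidedIdeal R).jacobson.ringCon.Quotient
  obtain ⟨a, rfl⟩ := hπs g
  obtain ⟨e, he, hea⟩ := hlift a <| by
    rw [← hπ, map_sub, map_mul, hg.eq, sub_self]
  have hea : π e = π a := by rwa [← hπ, map_sub, sub_eq_zero] at hea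
  rw [← hea] at hg hgc hφ hψ
  have hfinq (T : Type u) [Ring T] [Finite T] (ψ : R →+* T)
      (h : ∀ x, π x = 0 → ψ x = 0) : ψ e = 0 := by
    have := hψ T (π.liftOfSurjective hπs ⟨ψ, h⟩)
    rwa [RingHom.liftOfRightInverse_comp_apply] at this
  have hcen : e ∈ Set.center R := by
    refine mem_center_of_finite_quotients π (fun x hx ↦ (hJ x).1 ((hπ x).1 hx)) he
      (fun r ↦ hgc _) (φ.comp π) (fun x hx ↦ ?_) hfinq
    rw [map_mul, map_sub, map_one]
    exact hφ _ hx
  have hsimple (M : Type u) [AddCommGroup M] [Module Rᵐᵒᵖ M] [IsSimpleModule Rᵐᵒᵖ M] (x : R)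
      (hx : π x = 0) (m : M) : op x • m = 0 :=
    mem_jacobson_smul_eq_zero (op_mem_jacobson ((hJ x).1 ((hπ x).1 hx))) m
  obtain rfl | rfl := hind.2 e he hcen
  · intro M _ _ hM
    induction hM with
    | of_subsingleton => infer_instance
    | @of_simple_quotient M _ _ N _ _ ih =>
      have : Finite (M ⧸ N) := by
        refine finite_of_fg_of_smul_eq_zero (φ.comp π).op fun r hr m ↦ ?_
        refine hsimple _ r.unop ?_ m
        simpa using hφ _ (op_injective hr)
      have : Finite (M ⧸ N.toAddSubgroup) := this
      exact Finite.of_addSubgroup_quotient N.toAddSubgroup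
  · obtain ⟨M, _, _, _, _⟩ := hfin
    have h := hfinq (AddMonoid.End M)ᵐᵒᵖ
      ((RingHom.op (Module.toAddMonoidEnd Rᵐᵒᵖ M)).comp (RingEquiv.opOp R).toRingHom)
      fun x hx ↦ unop_injective <| by
        ext m
        exact hsimple M x hx m
    have := IsSimpleModule.nontrivial Rᵐᵒᵖ M
    obtain ⟨m, hm⟩ := exists_ne (0 : M)
    rw [map_one] at h
    exact (hm (DFunLike.congr_fun (congr_arg unop h) m)).elim
end

section
/- Let R be a semilocal ring that is left noetherian and right noetherian, and let S and T be simple right R-modules that are not isomorphic and satisfy Ext^1_R(S, T) ≠ 0 (i.e., there exists a non-split short exact sequence 0 → T → K → S → 0 of right R-modules). Then either both S and T are finite sets, or S and T have the same (infinite) cardinality. -/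
universe u

/-- Two types are both finite, or both infinite of the same cardinality. -/
def SameSize (X Y : Type u) : Prop :=
  (Finite X ∧ Finite Y) ∨ (Infinite X ∧ Infinite Y ∧ Cardinal.mk X = Cardinal.mk Y)

namespace SameSize

variable {X Y Z : Type u}

theorem symm (h : SameSize X Y) : SameSize Y X := by
  rcases h with ⟨h₁, h₂⟩ | ⟨h₁, h₂, h⟩
  · exact Or.inl ⟨h₂, h₁⟩
  · exact Or.inr ⟨h₂, h₁, h.symm⟩

theorem trans (h : SameSize X Y) (h' : SameSize Y Z) : SameSize X Z := by
  rcases h with ⟨h₁, h₂⟩ | ⟨h₁, h₂, h⟩ <;> rcases h' with ⟨h₃, h₄⟩ | ⟨h₃, h₄, h'⟩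
  · exact Or.inl ⟨h₁, h₄⟩
  · exact (not_finite Y).elim
  · exact (not_finite Y).elim
  · exact Or.inr ⟨h₁, h₄, h.trans h'⟩

theorem of_equiv (e : X ≃ Y) : SameSize X Y := by
  rcases finite_or_infinite X with h | h
  · exact Or.inl ⟨h, Finite.of_equiv X e⟩
  · exact Or.inr ⟨h, Infinite.of_injective e e.injective, Cardinal.mk_congr e⟩

theorem mk_le_of_injective_pi [Infinite Y] {ι : Type} [Finite ι] {f : X → ι → Y}
    (hf : Function.Injective f) : Cardinal.mk X ≤ Cardinal.mk Y := by
  have := Fintype.ofFinite ι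
  have h : Cardinal.lift.{0, u} (Cardinal.mk X) ≤ Cardinal.lift.{u, u} (Cardinal.mk (ι → Y)) :=
    by simpa using Cardinal.mk_le_of_injective hf
  refine (by simpa using h : Cardinal.mk X ≤ Cardinal.mk Y ^ Fintype.card ι).trans ?_
  exact Cardinal.power_nat_le (Cardinal.aleph0_le_mk Y)

theorem of_injective_pi {ι κ : Type} [Finite ι] [Finite κ] {f : X → ι → Y}
    (hf : Function.Injective f) {g : Y → κ → X} (hg : Function.Injective g) : SameSize X Y := by
  rcases finite_or_infinite Y with h | h
  · exact Or.inl ⟨Finite.of_injective f hf, h⟩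
  · rcases finite_or_infinite X with h' | h'
    · exact Or.inl ⟨h', Finite.of_injective g hg⟩
    · exact Or.inr ⟨h', h, (mk_le_of_injective_pi hf).antisymm (mk_le_of_injective_pi hg)⟩

theorem quotient {A B M N : Type u} [Ring A] [Ring B] [AddCommGroup M] [AddCommGroup N]
    [Module A M] [Module B N] (e : M ≃+ N) {p : Submodule A M} {q : Submodule B N}
    (h : ∀ x, x ∈ p ↔ e x ∈ q) : SameSize (M ⧸ p) (N ⧸ q) := by
  refine of_equiv (Quotient.congr e.toEquiv fun x y => ?_)
  have h₁ : p.quotientRel x y ↔ x - y ∈ p := Submodule.quotientRel_def p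
  have h₂ : q.quotientRel (e x) (e y) ↔ e x - e y ∈ q := Submodule.quotientRel_def q
  refine h₁.trans (Iff.trans ?_ h₂.symm)
  rw [h, map_sub]

/-- A finitely generated module over a ring `A` which is annihilated by the kernel of a surjection
onto an artinian ring has the same size as `A` modulo its annihilator. -/
theorem of_annihilator {A Q M : Type u} [Ring A] [Ring Q] [IsArtinianRing Q] (f : A →+* Q)
    (hf : Function.Surjective f) [AddCommGroup M] [Module A M] [Module.Finite A M]
    (hk : ∀ a, f a = 0 → ∀ m : M, a • m = 0) (I : Ideal A)
    (hI : ∀ a, a ∈ I ↔ ∀ m : M, a • m = 0) : SameSize M (A ⧸ I) := by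
  obtain ⟨n, s, hs⟩ := Module.Finite.exists_fin (R := A) (M := M)
  have hsurj : Function.Surjective fun (c : Fin n → A ⧸ I) => ∑ i, (c i).out • s i := by
    intro m
    obtain ⟨c, rfl⟩ := (Submodule.mem_span_range_iff_exists_fun A).1
      (hs ▸ Submodule.mem_top : m ∈ Submodule.span A (Set.range s))
    refine ⟨fun i => Submodule.Quotient.mk (c i), Finset.sum_congr rfl fun i _ => ?_⟩
    have : (Submodule.Quotient.mk (c i) : A ⧸ I).out - c i ∈ I :=
      (Submodule.Quotient.eq I).1 (Quotient.out_eq _)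
    rw [← sub_eq_zero, ← sub_smul]
    exact (hI _).1 this _
  have : RingHomSurjective f := ⟨hf⟩
  let N (m : M) : Ideal Q :=
    Submodule.map f.toSemilinearMap (LinearMap.ker (LinearMap.toSpanSingleton A M m))
  have hN (m : M) (a : A) : f a ∈ N m ↔ a • m = 0 := by
    constructor
    · rintro ⟨b, hb, hba⟩
      have hb' : b • m = 0 := hb
      have hba' : f b = f a := hba
      have := hk (a - b) (by rw [map_sub, hba', sub_self]) m
      rwa [sub_smul, hb', sub_zero] at this
    · intro h
      exact ⟨a, h, rfl⟩
  obtain ⟨t, ht⟩ := Finset.exists_inf_le N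
  have hinj : Function.Injective fun (x : A ⧸ I) (i : Fin t.card) =>
      x.out • (t.equivFin.symm i : M) := by
    intro x y hxy
    rw [← Quotient.out_eq x, ← Quotient.out_eq y]
    refine (Submodule.Quotient.eq I).2 ((hI _).2 fun m => (hN _ _).1 (ht m ?_))
    refine (Submodule.mem_finsetInf).2 fun k hk => (hN _ _).2 ?_
    have := congrFun hxy (t.equivFin ⟨k, hk⟩)
    simpa [sub_smul, sub_eq_zero] using this
  exact of_injective_pi (Function.injective_surjInv hsurj) hinj

end SameSize

/-- A module annihilated by the kernel of a surjection onto a semisimple ring is semisimple. -/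
theorem isSemisimpleModule_of_surjective {A Q M : Type*} [Ring A] [Ring Q] [IsSemisimpleRing Q]
    (f : A →+* Q) (hf : Function.Surjective f) [AddCommGroup M] [Module A M]
    (hk : ∀ a, f a = 0 → ∀ m : M, a • m = 0) : IsSemisimpleModule A M := by
  have key (a b : A) (h : f a = f b) (m : M) : a • m = b • m := by
    rw [← sub_eq_zero, ← sub_smul]
    exact hk _ (by rw [map_sub, h, sub_self]) m
  have hr := Function.surjInv_eq hf
  let : Module Q M :=
    { smul := fun q m => Function.surjInv hf q • m
      one_smul := fun m => (key _ 1 (by rw [hr, map_one]) m).trans (one_smul _ _)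
      mul_smul := fun q q' m => (key _ _ (by rw [hr, map_mul, hr, hr]) m).trans (mul_smul _ _ m)
      smul_zero := fun q => smul_zero _
      zero_smul := fun m => (key _ 0 (by rw [hr, map_zero]) m).trans (zero_smul _ _)
      smul_add := fun q => smul_add _
      add_smul := fun q q' m =>
        (key _ _ (by rw [hr, map_add, hr, hr]) m).trans (add_smul _ _ m) }
  have : RingHomSurjective f := ⟨hf⟩
  let e : M →ₛₗ[f] M :=
    { AddMonoidHom.id M with map_smul' := fun a m => (key _ _ (hr (f a)) m).symm }
  exact (e.isSemisimpleModule_iff_of_bijective Function.bijective_id).2 inferInstance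

/-- The Jacobson radical annihilates the simple right modules. -/
theorem smul_eq_zero_of_mem_jacobson {R S : Type*} [Ring R] [AddCommGroup S] [Module Rᵐᵒᵖ S]
    [IsSimpleModule Rᵐᵒᵖ S] {x : R} (hx : x ∈ (⊥ : TwoSidedIdeal R).jacobson) (s : S) :
    MulOpposite.op x • s = 0 := by
  have left_inv {y : R} (hy : y ∈ (⊥ : TwoSidedIdeal R).jacobson) : ∃ z, z * (1 - y) = 1 := by
    obtain ⟨z, hz⟩ := TwoSidedIdeal.mem_jacobson_iff.1 hy (-1)
    refine ⟨z, sub_eq_zero.1 ?_⟩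
    rw [TwoSidedIdeal.mem_bot] at hz
    rw [← hz]
    noncomm_ring
  by_contra h
  obtain ⟨b, hb⟩ := (IsSimpleModule.toSpanSingleton_surjective Rᵐᵒᵖ h) s
  obtain ⟨r, rfl⟩ := MulOpposite.op_surjective b
  have hy := TwoSidedIdeal.mul_mem_right _ x r hx
  have hb : MulOpposite.op (x * r) • s = s := by
    simpa [← mul_smul] using hb
  obtain ⟨z, hz⟩ := left_inv hy
  obtain ⟨w, hw⟩ := left_inv (TwoSidedIdeal.neg_mem _ (TwoSidedIdeal.mul_mem_left _ z _ hy))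
  have hz' : 1 - -(z * (x * r)) = z := by
    rw [mul_sub, mul_one] at hz
    rw [sub_neg_eq_add]
    exact (sub_eq_iff_eq_add.1 hz).symm
  rw [hz'] at hw
  rw [left_inv_eq_right_inv hw hz] at hw
  have h0 : MulOpposite.op (1 - x * r) • s = 0 := by
    rw [MulOpposite.op_sub, sub_smul, hb, MulOpposite.op_one, one_smul, sub_self]
  have hs : s = 0 := by
    rw [← one_smul Rᵐᵒᵖ s, ← MulOpposite.op_one, ← hw, MulOpposite.op_mul, mul_smul, h0, smul_zero]
  exact h (by rw [hs, smul_zero])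

/-- Let `R` be a semilocal, left and right noetherian ring and let `S` and `T` be
simple non-isomorphic right `R`-modules with `Ext¹_R(S, T) ≠ 0`.  Then `S` and `T`
are either both finite or have the same infinite cardinality. -/
theorem cardinalities_of_ext_ne_zero (R : Type u) [Ring R]
    (hsemilocal : IsSemisimpleRing ((⊥ : TwoSidedIdeal R).jacobson.ringCon.Quotient))
    (hln : IsNoetherianRing R) (hrn : IsNoetherianRing Rᵐᵒᵖ)
    (S T : Type u) [AddCommGroup S] [Module Rᵐᵒᵖ S] [AddCommGroup T] [Module Rᵐᵒᵖ T]
    (hS : IsSimpleModule Rᵐᵒᵖ S) (hT : IsSimpleModule Rᵐᵒᵖ T)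
    (hniso : IsEmpty (S ≃ₗ[Rᵐᵒᵖ] T))
    (hext : ExtOne Rᵐᵒᵖ S T) :
    (Finite S ∧ Finite T) ∨
      (Infinite S ∧ Infinite T ∧ Cardinal.mk S = Cardinal.mk T) := by
  obtain ⟨K, _, _, i, p, hi, hp, hip, hsplit⟩ := hext
  have hJS (x : R) (hx : x ∈ (⊥ : TwoSidedIdeal R).jacobson) (s : S) :=
    smul_eq_zero_of_mem_jacobson hx s
  have hJT (x : R) (hx : x ∈ (⊥ : TwoSidedIdeal R).jacobson) (t : T) :=
    smul_eq_zero_of_mem_jacobson hx t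
  generalize (⊥ : TwoSidedIdeal R).jacobson = J at *
  let f : R →+* J.ringCon.Quotient := J.ringCon.mk'
  have hf : Function.Surjective f := J.ringCon.mk'_surjective
  have hfker (r : R) : f r = 0 ↔ r ∈ J := by
    rw [← TwoSidedIdeal.mem_ker, TwoSidedIdeal.ker_ringCon_mk']
  have hfop : Function.Surjective f.op := fun q => by
    obtain ⟨r, hr⟩ := hf q.unop
    exact ⟨.op r, MulOpposite.unop_injective hr⟩
  have hfopker (r : Rᵐᵒᵖ) (h : f.op r = 0) : r.unop ∈ J :=
    (hfker _).1 (congrArg MulOpposite.unop h)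
  have hmem (k : K) (hk : p k = 0) : ∃ t, i t = k := by
    have : k ∈ LinearMap.range i := hip ▸ hk
    exact this
  have hpi (t : T) : p (i t) = 0 := by
    have : i t ∈ LinearMap.ker p := hip ▸ LinearMap.mem_range_self i t
    exact this
  have hJK (x : R) (hx : x ∈ J) (k : K) : ∃ t, i t = MulOpposite.op x • k :=
    hmem _ (by rw [map_smul, hJS x hx])
  have hJi (x : R) (hx : x ∈ J) (t : T) : MulOpposite.op x • i t = 0 := by
    rw [← map_smul, hJT x hx, map_zero]
  obtain ⟨x₀, hx₀, k₀, hne⟩ : ∃ x ∈ J, ∃ k : K, MulOpposite.op x • k ≠ 0 := by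
    by_contra! h
    have : IsSemisimpleModule Rᵐᵒᵖ K :=
      isSemisimpleModule_of_surjective f.op hfop fun a ha => h a.unop (hfopker a ha)
    obtain ⟨s, hs⟩ := IsSemisimpleModule.lifting_property p hp LinearMap.id
    exact hsplit s hs
  -- The bimodule `J ⧸ (J ∩ ann K)`, first as a left and then as a right module.
  let U : Ideal R :=
    { carrier := {x | ∀ k : K, MulOpposite.op x • k = 0}
      add_mem' := fun ha hb k => by rw [MulOpposite.op_add, add_smul, ha, hb, add_zero]
      zero_mem' := fun k => by simp
      smul_mem' := fun r x hx k => by rw [smul_eq_mul, MulOpposite.op_mul, mul_smul, hx] }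
  let U' : Ideal Rᵐᵒᵖ := Module.annihilator Rᵐᵒᵖ K
  let L : Ideal R := J.asIdeal
  let L' : Ideal Rᵐᵒᵖ := J.asIdealOpposite
  let V : Submodule R L := U.submoduleOf L
  let V' : Submodule Rᵐᵒᵖ L' := U'.submoduleOf L'
  have hLmem (x : R) : x ∈ L ↔ x ∈ J := TwoSidedIdeal.mem_asIdeal
  have hLmem' (x : Rᵐᵒᵖ) : x ∈ L' ↔ x.unop ∈ J :=
    TwoSidedIdeal.mem_asIdealOpposite
  have hV (x : L) : x ∈ V ↔ ∀ k : K, MulOpposite.op (x : R) • k = 0 := Iff.rfl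
  have hV' (x : L') : x ∈ V' ↔ ∀ k : K, (x : Rᵐᵒᵖ) • k = 0 :=
    Module.mem_annihilator
  let e : L ≃+ L' :=
    { toFun := fun x => ⟨.op x, (hLmem' _).2 ((hLmem _).1 x.2)⟩
      invFun := fun x => ⟨x.1.unop, (hLmem _).2 ((hLmem' _).1 x.2)⟩
      left_inv := fun x => rfl
      right_inv := fun x => rfl
      map_add' := fun x y => rfl }
  have hB : SameSize (L ⧸ V) (L' ⧸ V') :=
    SameSize.quotient e fun x => (hV x).trans (hV' (e x)).symm
  have hannL (r : R) : (∀ b : L ⧸ V, r • b = 0) ↔ ∀ s : S, MulOpposite.op r • s = 0 := by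
    have h1 : (∀ b : L ⧸ V, r • b = 0) ↔
        ∀ x ∈ J, ∀ k : K, MulOpposite.op x • MulOpposite.op r • k = 0 := by
      constructor
      · intro h x hx k
        have := (hV _).1 ((Submodule.Quotient.mk_eq_zero V).1
          (h (Submodule.Quotient.mk ⟨x, (hLmem x).2 hx⟩))) k
        simpa [mul_smul] using this
      · intro h b
        obtain ⟨⟨x, hx⟩, rfl⟩ := Submodule.Quotient.mk_surjective V b
        refine (Submodule.Quotient.mk_eq_zero V).2 ((hV _).2 fun k => ?_)
        simpa [mul_smul] using h x ((hLmem x).1 hx) k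
    rw [h1]
    constructor
    · intro h s
      by_contra hs
      obtain ⟨k₁, rfl⟩ := hp s
      obtain ⟨b, hb⟩ := IsSimpleModule.toSpanSingleton_surjective Rᵐᵒᵖ hs (p k₀)
      obtain ⟨c, rfl⟩ := MulOpposite.op_surjective b
      obtain ⟨t, ht⟩ := hmem (k₀ - MulOpposite.op c • MulOpposite.op r • k₁) (by
        rw [map_sub, map_smul, map_smul, ← hb]; simp)
      have h2 := hJi x₀ hx₀ t
      have h3 := h (c * x₀) (J.mul_mem_left _ _ hx₀) k₁
      rw [MulOpposite.op_mul, mul_smul] at h3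
      rw [ht, smul_sub, h3, sub_zero] at h2
      exact hne h2
    · intro h x hx k
      obtain ⟨t, ht⟩ := hmem (MulOpposite.op r • k) (by rw [map_smul, h])
      rw [← ht, hJi x hx]
  have hannR (r : Rᵐᵒᵖ) : (∀ b : L' ⧸ V', r • b = 0) ↔ ∀ t : T, r • t = 0 := by
    have h1 : (∀ b : L' ⧸ V', r • b = 0) ↔ ∀ x ∈ J, ∀ k : K, r • MulOpposite.op x • k = 0 := by
      constructor
      · intro h x hx k
        have := (hV' _).1 ((Submodule.Quotient.mk_eq_zero V').1
          (h (Submodule.Quotient.mk ⟨.op x, (hLmem' _).2 hx⟩))) k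
        simpa [mul_smul] using this
      · intro h b
        obtain ⟨⟨x, hx⟩, rfl⟩ := Submodule.Quotient.mk_surjective V' b
        refine (Submodule.Quotient.mk_eq_zero V').2 ((hV' _).2 fun k => ?_)
        simpa [mul_smul] using h x.unop ((hLmem' x).1 hx) k
    rw [h1]
    constructor
    · intro h t
      obtain ⟨t₀, ht₀⟩ := hJK x₀ hx₀ k₀
      have ht₀' : t₀ ≠ 0 := fun h0 => hne (by rw [← ht₀, h0, map_zero])
      obtain ⟨b, rfl⟩ := IsSimpleModule.toSpanSingleton_surjective Rᵐᵒᵖ ht₀' t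
      obtain ⟨c, rfl⟩ := MulOpposite.op_surjective b
      refine hi ?_
      have := h (x₀ * c) (J.mul_mem_right _ _ hx₀) k₀
      rw [MulOpposite.op_mul, mul_smul, ← ht₀] at this
      simpa using this
    · intro h x hx k
      obtain ⟨t, ht⟩ := hJK x hx k
      rw [← ht, ← map_smul, h, map_zero]
  let P : Ideal Rᵐᵒᵖ := Module.annihilator Rᵐᵒᵖ S
  let P' : Ideal R := Module.annihilator R (L ⧸ V)
  let Q : Ideal Rᵐᵒᵖ := Module.annihilator Rᵐᵒᵖ T
  have hSP : SameSize S (Rᵐᵒᵖ ⧸ P) :=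
    .of_annihilator f.op hfop (fun a ha => hJS a.unop (hfopker a ha)) P
      fun _ => Module.mem_annihilator
  have hBP : SameSize (L ⧸ V) (R ⧸ P') :=
    .of_annihilator f hf (fun a ha => (hannL a).2 (hJS a ((hfker a).1 ha))) P'
      fun _ => Module.mem_annihilator
  have hPP : SameSize (R ⧸ P') (Rᵐᵒᵖ ⧸ P) :=
    .quotient MulOpposite.opAddEquiv fun r =>
      Module.mem_annihilator.trans ((hannL r).trans Module.mem_annihilator.symm)
  have hBQ : SameSize (L' ⧸ V') (Rᵐᵒᵖ ⧸ Q) :=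
    .of_annihilator f.op hfop (fun a ha => (hannR a).2 (hJT a.unop (hfopker a ha))) Q
      fun a => Module.mem_annihilator.trans (hannR a).symm
  have hTQ : SameSize T (Rᵐᵒᵖ ⧸ Q) :=
    .of_annihilator f.op hfop (fun a ha => hJT a.unop (hfopker a ha)) Q
      fun _ => Module.mem_annihilator
  exact hSP.trans (hPP.symm.trans (hBP.symm.trans (hB.trans (hBQ.trans hTQ.symm))))
end

section
/- Let R be a quasi-Frobenius ring, i.e., R is left artinian and right artinian, R is injective as a right module over itself, and R is injective as a left module over itself. Let P be a finitely generated indecomposable projective right R-module, let S = P/J(P) be its (simple) top and let T = Soc(P) be its socle, which is a simple right R-module. Then the endomorphism rings End_R(S) and End_R(T) are isomorphic as rings. -/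
universe u

universe v w

section NilpotentOrUnit

/-- If every element of a ring is nilpotent or a unit, the kernel of a homomorphism to a
nontrivial reduced ring consists of the nilpotent elements. -/
theorem RingHom.mem_ker_iff_isNilpotent_of_isNilpotent_or_isUnit {E D : Type*} [Ring E] [Ring D]
    [Nontrivial D] [IsReduced D] (hE : ∀ x : E, IsNilpotent x ∨ IsUnit x) (φ : E →+* D) (x : E) :
    x ∈ RingHom.ker φ ↔ IsNilpotent x := by
  rw [RingHom.mem_ker]
  refine ⟨fun hx ↦ (hE x).resolve_right fun hu ↦ ?_, fun hx ↦ (hx.map φ).eq_zero⟩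
  exact not_isUnit_zero (hx ▸ hu.map φ)

/-- If every element of a ring is nilpotent or a unit, any two of its nontrivial reduced
quotients are isomorphic. -/
theorem nonempty_ringEquiv_of_isNilpotent_or_isUnit {E D D' : Type*} [Ring E] [Ring D] [Ring D']
    [Nontrivial D] [IsReduced D] [Nontrivial D'] [IsReduced D']
    (hE : ∀ x : E, IsNilpotent x ∨ IsUnit x) {φ : E →+* D} {ψ : E →+* D'}
    (hφ : Function.Surjective φ) (hψ : Function.Surjective ψ) : Nonempty (D ≃+* D') := by
  have hker : RingHom.ker φ = RingHom.ker ψ := by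
    ext x
    rw [φ.mem_ker_iff_isNilpotent_of_isNilpotent_or_isUnit hE,
      ψ.mem_ker_iff_isNilpotent_of_isNilpotent_or_isUnit hE]
  exact ⟨(RingHom.quotientKerEquivOfSurjective hφ).symm.trans
    ((Ideal.quotEquivOfEq hker).trans (RingHom.quotientKerEquivOfSurjective hψ))⟩

end NilpotentOrUnit

section Endomorphisms

variable {A : Type*} [Ring A] {M : Type v} [AddCommGroup M] [Module A M]

/-- Fitting's lemma: an endomorphism of an indecomposable module of finite length is nilpotent
or invertible. -/
theorem Module.End.isNilpotent_or_isUnit [IsArtinian A M] [IsNoetherian A M]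
    (h : ∀ N N' : Submodule A M, IsCompl N N' → N = ⊥ ∨ N = ⊤) (f : Module.End A M) :
    IsNilpotent f ∨ IsUnit f := by
  obtain ⟨n, hn⟩ := Filter.eventually_atTop.mp (LinearMap.eventually_isCompl_ker_pow_range_pow f)
  have hc := hn (n + 1) n.le_succ
  rcases h _ _ hc with hbot | htop
  · right
    rw [hbot] at hc
    have hu : IsUnit (f ^ (n + 1)) := (Module.End.isUnit_iff _).mpr
      ⟨LinearMap.ker_eq_bot.mp hbot, LinearMap.range_eq_top.mp (eq_top_of_bot_isCompl hc)⟩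
    exact (isUnit_pow_iff n.succ_ne_zero).mp hu
  · exact Or.inl ⟨n + 1, LinearMap.ker_eq_top.mp htop⟩

/-- A nonzero semisimple module all of whose endomorphisms are nilpotent or invertible is
simple. -/
theorem IsSemisimpleModule.isSimpleModule_of_isNilpotent_or_isUnit [IsSemisimpleModule A M]
    [Nontrivial M] (h : ∀ f : Module.End A M, IsNilpotent f ∨ IsUnit f) : IsSimpleModule A M := by
  refine (isSimpleModule_iff A M).mpr { eq_bot_or_eq_top := fun N ↦ ?_ }
  obtain ⟨N', hN⟩ := exists_isCompl N
  have hp : IsIdempotentElem (N.projection N' hN) := Submodule.isIdempotentElem_projection hN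
  rcases h (N.projection N' hN) with hnil | hu
  · left
    have h0 : N.projection N' hN = 0 := by
      obtain ⟨n, hn⟩ := hnil
      have := hp.pow_succ_eq n
      rw [pow_succ, hn, zero_mul] at this
      exact this.symm
    rw [← Submodule.range_projection hN, h0, LinearMap.range_zero]
  · right
    rw [← Submodule.range_projection hN]
    exact LinearMap.range_eq_top.mpr ((Module.End.isUnit_iff _).mp hu).2

/-- Restriction of endomorphisms to a fully invariant submodule. -/
def Submodule.restrictEndHom (N : Submodule A M) (hN : ∀ f : Module.End A M, N ≤ N.comap f) :
    Module.End A M →+* Module.End A N where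
  toFun f := f.restrict (hN f)
  map_one' := rfl
  map_mul' _ _ := rfl
  map_zero' := rfl
  map_add' _ _ := rfl

/-- The action of endomorphisms on the quotient by a fully invariant submodule. -/
def Submodule.mapQEndHom (N : Submodule A M) (hN : ∀ f : Module.End A M, N ≤ N.comap f) :
    Module.End A M →+* Module.End A (M ⧸ N) where
  toFun f := N.mapQ N f (hN f)
  map_one' := by ext; rfl
  map_mul' _ _ := by ext; rfl
  map_zero' := by ext; rfl
  map_add' _ _ := by ext; rfl

/-- A nonzero semisimple module is simple if its endomorphism ring is a quotient of a ring all of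
whose elements are nilpotent or units. -/
theorem IsSemisimpleModule.isSimpleModule_of_end_surjective {E : Type*} [Ring E]
    [IsSemisimpleModule A M] [Nontrivial M] (hE : ∀ x : E, IsNilpotent x ∨ IsUnit x)
    {φ : E →+* Module.End A M} (hφ : Function.Surjective φ) : IsSimpleModule A M := by
  refine isSimpleModule_of_isNilpotent_or_isUnit fun f ↦ ?_
  obtain ⟨x, rfl⟩ := hφ f
  exact (hE x).imp (fun h ↦ h.map φ) (fun h ↦ h.map φ)

theorem IsSimpleModule.isReduced_end [IsSimpleModule A M] : IsReduced (Module.End A M) := by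
  classical infer_instance

/-- Two nonzero semisimple modules whose endomorphism rings are quotients of the same ring, all
of whose elements are nilpotent or invertible, have isomorphic endomorphism rings. -/
theorem IsSemisimpleModule.nonempty_end_ringEquiv {E M' : Type*} [Ring E] [AddCommGroup M']
    [Module A M'] [IsSemisimpleModule A M] [Nontrivial M] [IsSemisimpleModule A M'] [Nontrivial M']
    (hE : ∀ x : E, IsNilpotent x ∨ IsUnit x)
    {φ : E →+* Module.End A M} (hφ : Function.Surjective φ)
    {ψ : E →+* Module.End A M'} (hψ : Function.Surjective ψ) :
    Nonempty (Module.End A M ≃+* Module.End A M') := by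
  have := isSimpleModule_of_end_surjective hE hφ
  have := isSimpleModule_of_end_surjective hE hψ
  have : IsReduced (Module.End A M) := IsSimpleModule.isReduced_end
  have : IsReduced (Module.End A M') := IsSimpleModule.isReduced_end
  exact nonempty_ringEquiv_of_isNilpotent_or_isUnit hE hφ hψ

theorem Submodule.restrictEndHom_surjective [Small.{v} A] [Module.Injective A M]
    (N : Submodule A M) (hN : ∀ f : Module.End A M, N ≤ N.comap f) :
    Function.Surjective (N.restrictEndHom hN) := fun g ↦ by
  obtain ⟨f, hf⟩ := Module.Injective.extension_property A M N M N.subtype N.injective_subtype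
    (N.subtype ∘ₗ g)
  exact ⟨f, LinearMap.ext fun x ↦ Subtype.ext (LinearMap.congr_fun hf x)⟩

theorem Submodule.mapQEndHom_surjective [Module.Projective A M]
    (N : Submodule A M) (hN : ∀ f : Module.End A M, N ≤ N.comap f) :
    Function.Surjective (N.mapQEndHom hN) := fun g ↦ by
  obtain ⟨f, hf⟩ := Module.projective_lifting_property N.mkQ (g ∘ₗ N.mkQ) N.mkQ_surjective
  refine ⟨f, ?_⟩
  ext x
  exact LinearMap.congr_fun hf x

end Endomorphisms

/-- A retract of an injective module is injective. -/
theorem Module.Injective.of_leftInverse {A : Type*} [Ring A] {M : Type v} {N : Type w}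
    [AddCommGroup M] [AddCommGroup N] [Module A M] [Module A N] [Small.{v} A]
    [Module.Injective A M] (i : N →ₗ[A] M) (p : M →ₗ[A] N) (h : p ∘ₗ i = .id) :
    Module.Injective A N := by
  refine ⟨fun X Y _ _ _ _ f hf g ↦ ?_⟩
  obtain ⟨k, hk⟩ := Module.Injective.extension_property A M X Y f hf (i ∘ₗ g)
  refine ⟨p ∘ₗ k, fun x ↦ ?_⟩
  have h1 := LinearMap.congr_fun hk x
  have h2 := LinearMap.congr_fun h (g x)
  exact (congr_arg p h1).trans h2

/-- Finitely generated projective modules over a self-injective ring are injective. -/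
theorem Module.Injective.of_finite_projective {A : Type u} [Ring A] [Module.Injective A A]
    {P : Type u} [AddCommGroup P] [Module A P] [Module.Finite A P] [Module.Projective A P] :
    Module.Injective A P := by
  obtain ⟨n, p, i, -, -, h⟩ := Module.Finite.exists_comp_eq_id_of_projective A P
  exact .of_leftInverse i p h

section Socle

variable {A : Type u} [Ring A] {M : Type u} [AddCommGroup M] [Module A M]

theorem Socle_le_comap (f : Module.End A M) : Socle A M ≤ (Socle A M).comap f := by
  refine sSup_le fun N (hN : IsSimpleModule A N) ↦ ?_
  rw [← Submodule.map_le_iff_le_comap, ← LinearMap.range_domRestrict]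
  rcases LinearMap.injective_or_eq_zero (f.domRestrict N) with h | h
  · exact le_sSup (IsSimpleModule.congr (LinearEquiv.ofInjective _ h).symm)
  · simp [h]

theorem isSemisimpleModule_Socle : IsSemisimpleModule A (Socle A M) := by
  rw [Socle, sSup_eq_iSup]
  exact isSemisimpleModule_biSup_of_isSemisimpleModule_submodule
    fun N (hN : IsSimpleModule A N) ↦ inferInstance

theorem nontrivial_Socle [IsArtinian A M] [Nontrivial M] : Nontrivial (Socle A M) := by
  obtain ⟨N, hN, -⟩ := (eq_bot_or_exists_atom_le (⊤ : Submodule A M)).resolve_left top_ne_bot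
  have hle : N ≤ Socle A M := le_sSup (isSimpleModule_iff_isAtom.mpr hN)
  exact Submodule.nontrivial_iff_ne_bot.mpr fun h ↦ hN.1 (le_bot_iff.mp (h ▸ hle))

end Socle

section Radical

theorem Ring.mem_jacobson_of_forall_isNilpotent {A : Type*} [Ring A] {x : A}
    (h : ∀ y, IsNilpotent (y * x)) : x ∈ Ring.jacobson A := by
  rw [← Ideal.jacobson_bot, Ideal.mem_jacobson_iff]
  intro y
  obtain ⟨u, hu⟩ := (h y).isUnit_one_add
  refine ⟨↑u⁻¹, ?_⟩
  have : (↑u⁻¹ : A) * (1 + y * x) = 1 := by rw [← hu, Units.inv_mul]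
  rw [Ideal.mem_bot, sub_eq_zero, ← this]
  noncomm_ring

theorem Ring.isNilpotent_of_mem_jacobson {A : Type*} [Ring A] [IsArtinianRing A] {x : A}
    (h : x ∈ Ring.jacobson A) : IsNilpotent x := by
  obtain ⟨n, hn⟩ := IsSemiprimaryRing.isNilpotent (R := A)
  exact ⟨n, by simpa [hn] using Ideal.pow_mem_pow h n⟩

theorem MulOpposite.isNilpotent_op_iff {A : Type*} [MonoidWithZero A] {x : A} :
    IsNilpotent (MulOpposite.op x) ↔ IsNilpotent x := by
  simp only [IsNilpotent, ← MulOpposite.op_pow, MulOpposite.op_eq_zero_iff]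

/-- The Jacobson radical of a left and right artinian ring is left-right symmetric. -/
theorem Ring.op_mem_jacobson_iff {R : Type*} [Ring R] [IsArtinianRing R] [IsArtinianRing Rᵐᵒᵖ]
    {r : R} : MulOpposite.op r ∈ Ring.jacobson Rᵐᵒᵖ ↔ r ∈ Ring.jacobson R := by
  constructor <;> refine fun h ↦ mem_jacobson_of_forall_isNilpotent fun y ↦ ?_
  · have := isNilpotent_of_mem_jacobson (Ideal.mul_mem_right (MulOpposite.op y) _ h)
    rwa [← MulOpposite.op_mul, MulOpposite.isNilpotent_op_iff] at this
  · rw [← MulOpposite.op_unop y, ← MulOpposite.op_mul, MulOpposite.isNilpotent_op_iff]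
    exact isNilpotent_of_mem_jacobson (Ideal.mul_mem_right _ _ h)

variable {R : Type u} [Ring R] {P : Type u} [AddCommGroup P] [Module Rᵐᵒᵖ P]

theorem TwoSidedIdeal.mem_jacobson_bot_iff {r : R} :
    r ∈ (⊥ : TwoSidedIdeal R).jacobson ↔ r ∈ Ring.jacobson R := by
  rw [TwoSidedIdeal.mem_jacobson_iff, ← Ideal.jacobson_bot, Ideal.mem_jacobson_iff]
  simp [TwoSidedIdeal.mem_bot]

theorem radSubmodule_le_comap (f : Module.End Rᵐᵒᵖ P) :
    radSubmodule R P ≤ (radSubmodule R P).comap f := by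
  refine Submodule.span_le.mpr ?_
  rintro _ ⟨r, hr, m, rfl⟩
  exact Submodule.subset_span ⟨r, hr, f m, map_smul f _ m⟩

variable [IsArtinianRing R] [IsArtinianRing Rᵐᵒᵖ]

theorem radSubmodule_eq_jacobson_smul :
    radSubmodule R P = Ring.jacobson Rᵐᵒᵖ • (⊤ : Submodule Rᵐᵒᵖ P) := by
  apply le_antisymm
  · refine Submodule.span_le.mpr ?_
    rintro _ ⟨r, hr, m, rfl⟩
    exact Submodule.smul_mem_smul (Ring.op_mem_jacobson_iff.mpr
      (TwoSidedIdeal.mem_jacobson_bot_iff.mp hr)) trivial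
  · refine Submodule.smul_le.mpr fun a ha m _ ↦ Submodule.subset_span
      ⟨a.unop, TwoSidedIdeal.mem_jacobson_bot_iff.mpr (Ring.op_mem_jacobson_iff.mp ha), m, rfl⟩

theorem isSemisimpleModule_quotient_radSubmodule :
    IsSemisimpleModule Rᵐᵒᵖ (P ⧸ radSubmodule R P) := by
  have h : Module.IsTorsionBySet Rᵐᵒᵖ (P ⧸ radSubmodule R P) (Ring.jacobson Rᵐᵒᵖ) := by
    rw [Module.isTorsionBySet_quotient_iff, radSubmodule_eq_jacobson_smul]
    exact fun m a ha ↦ Submodule.smul_mem_smul ha trivial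
  let _ := h.module
  exact (h.semilinearMap.isSemisimpleModule_iff_of_bijective Function.bijective_id).2 inferInstance

theorem nontrivial_quotient_radSubmodule [Module.Finite Rᵐᵒᵖ P] [Nontrivial P] :
    Nontrivial (P ⧸ radSubmodule R P) := by
  rw [Submodule.Quotient.nontrivial_iff, radSubmodule_eq_jacobson_smul]
  exact ((Ring.jacobson_smul_top_le _ _).trans_lt (Module.jacobson_lt_top _ _)).ne

end Radical

/-- Let `R` be a quasi-Frobenius ring (left and right artinian, injective as a left
and as a right module over itself) and let `P` be a finitely generated
indecomposable projective right `R`-module with top `S = P/J(P)` and socle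
`T = Soc(P)`.  Then `End_R(S)` and `End_R(T)` are isomorphic rings. -/
theorem end_top_iso_end_socle_of_QF (R : Type u) [Ring R]
    (hlart : IsArtinianRing R) (hrart : IsArtinianRing Rᵐᵒᵖ)
    (hlinj : Module.Injective R R) (hrinj : Module.Injective Rᵐᵒᵖ Rᵐᵒᵖ)
    (P : Type u) [AddCommGroup P] [Module Rᵐᵒᵖ P]
    (hfg : Module.Finite Rᵐᵒᵖ P) (hproj : Module.Projective Rᵐᵒᵖ P)
    (hindec : IsIndecomposableModule Rᵐᵒᵖ P) :
    Nonempty ((Module.End Rᵐᵒᵖ (P ⧸ radSubmodule R P)) ≃+*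
      (Module.End Rᵐᵒᵖ ↥(Socle Rᵐᵒᵖ P))) := by
  have := hindec.1
  have : Module.Injective Rᵐᵒᵖ P := .of_finite_projective
  have : IsSemisimpleModule Rᵐᵒᵖ (P ⧸ radSubmodule R P) := isSemisimpleModule_quotient_radSubmodule
  have : Nontrivial (P ⧸ radSubmodule R P) := nontrivial_quotient_radSubmodule
  have : IsSemisimpleModule Rᵐᵒᵖ (Socle Rᵐᵒᵖ P) := isSemisimpleModule_Socle
  have : Nontrivial (Socle Rᵐᵒᵖ P) := nontrivial_Socle
  exact IsSemisimpleModule.nonempty_end_ringEquiv (Module.End.isNilpotent_or_isUnit hindec.2)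
    (Submodule.mapQEndHom_surjective _ radSubmodule_le_comap)
    (Submodule.restrictEndHom_surjective _ Socle_le_comap)
end
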